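/- arXiv:1108.2521 — 3 statements merged into one kernel-verified Lean document; each statement's English description precedes it below -/
import Mathlib

section
/- If G is a properly edge-colored graph with minimum degree δ and more than (13/2)δ − 23/2 + 41/(8δ) vertices, then G contains a rainbow matching of size δ (a matching whose edges all have distinct colors). -/
open SimpleGraph

/-- A proper edge coloring: distinct edges sharing a vertex get distinct colors. -/
def IsProperEdgeColoring {V : Type*} (G : SimpleGraph V) (c : Sym2 V → ℕ) : Prop :=
  ∀ e₁ ∈ G.edgeSet, ∀ e₂ ∈ G.edgeSet, e₁ ≠ e₂ → (∃ v, v ∈ e₁ ∧ v ∈ e₂) → c e₁ ≠ c e₂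

/-- A rainbow matching: a set of pairwise disjoint edges of `G` with pairwise distinct colors. -/
def IsRainbowMatching {V : Type*} (G : SimpleGraph V) (c : Sym2 V → ℕ)
    (M : Finset (Sym2 V)) : Prop :=
  (M : Set (Sym2 V)) ⊆ G.edgeSet ∧
  (M : Set (Sym2 V)).Pairwise (fun e f => ∀ v, v ∈ e → v ∉ f) ∧
  Set.InjOn c (M : Set (Sym2 V))

section RM
open Classical

/-- A properly edge-colored graph, in relational form. -/
structure PG (V : Type*) where
  adj : V → V → Prop
  col : V → V → ℕ
  symm : ∀ u v, adj u v → adj v u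
  irrefl : ∀ u, ¬ adj u u
  colsymm : ∀ u v, col u v = col v u
  proper : ∀ u v w, adj u v → adj u w → col u v = col u w → v = w

variable {V : Type*}

/-- Rainbow matchings as sets of oriented edges. -/
def PG.RM (P : PG V) (M : Finset (V × V)) : Prop :=
  (∀ e ∈ M, P.adj e.1 e.2) ∧ ∀ e ∈ M, ∀ f ∈ M, e ≠ f →
    e.1 ≠ f.1 ∧ e.1 ≠ f.2 ∧ e.2 ≠ f.1 ∧ e.2 ≠ f.2 ∧ P.col e.1 e.2 ≠ P.col f.1 f.2

def Fr (M : Finset (V × V)) (v : V) : Prop := ∀ e ∈ M, v ≠ e.1 ∧ v ≠ e.2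

def PG.NC (P : PG V) (M : Finset (V × V)) (g : ℕ) : Prop := ∀ e ∈ M, P.col e.1 e.2 ≠ g

lemma PG.RM.insert {P : PG V} {M : Finset (V × V)} (h : P.RM M) {u v : V} (huv : P.adj u v)
    (hu : Fr M u) (hv : Fr M v) (hc : P.NC M (P.col u v)) :
    P.RM (insert (u, v) M) ∧ (insert (u, v) M).card = M.card + 1 := by
  have hn : (u, v) ∉ M := fun hm => (hu _ hm).1 rfl
  refine ⟨⟨?_, ?_⟩, Finset.card_insert_of_notMem hn⟩
  · intro e he
    rcases Finset.mem_insert.1 he with rfl | he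
    · exact huv
    · exact h.1 e he
  · intro e he f hf hef
    rcases Finset.mem_insert.1 he with rfl | he <;> rcases Finset.mem_insert.1 hf with rfl | hf
    · exact absurd rfl hef
    · have := hu f hf; have := hv f hf; have := hc f hf
      refine ⟨by tauto, by tauto, by tauto, by tauto, fun h => this h.symm⟩
    · have h1 := hu e he; have h2 := hv e he; have := hc e he
      exact ⟨fun h => h1.1 h.symm, fun h => h2.1 h.symm, fun h => h1.2 h.symm,
        fun h => h2.2 h.symm, this⟩
    · exact h.2 e he f hf hef

lemma PG.RM.erase {P : PG V} {M : Finset (V × V)} (h : P.RM M) (e : V × V) :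
    P.RM (M.erase e) :=
  ⟨fun f hf => h.1 f (Finset.mem_of_mem_erase hf), fun f hf g hg =>
    h.2 f (Finset.mem_of_mem_erase hf) g (Finset.mem_of_mem_erase hg)⟩

lemma Fr.erase {M : Finset (V × V)} {v : V} (h : Fr M v) (e : V × V) : Fr (M.erase e) v :=
  fun f hf => h f (Finset.mem_of_mem_erase hf)

lemma PG.NC.erase {P : PG V} {M : Finset (V × V)} {g : ℕ} (h : P.NC M g) (e : V × V) :
    P.NC (M.erase e) g :=
  fun f hf => h f (Finset.mem_of_mem_erase hf)

lemma Fr.insert {M : Finset (V × V)} {v a b : V} (h : Fr M v) (ha : v ≠ a) (hb : v ≠ b) :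
    Fr (insert (a, b) M) v := by
  intro f hf
  rcases Finset.mem_insert.1 hf with rfl | hf
  · exact ⟨ha, hb⟩
  · exact h f hf

lemma PG.NC.insert {P : PG V} {M : Finset (V × V)} {g : ℕ} {a b : V} (h : P.NC M g)
    (ha : P.col a b ≠ g) : P.NC (insert (a, b) M) g := by
  intro f hf
  rcases Finset.mem_insert.1 hf with rfl | hf
  · exact ha
  · exact h f hf

lemma PG.RM.fr1 {P : PG V} {M : Finset (V × V)} (h : P.RM M) {e : V × V} (he : e ∈ M) :
    Fr (M.erase e) e.1 := by
  intro f hf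
  have := h.2 e he f (Finset.mem_of_mem_erase hf) (Finset.ne_of_mem_erase hf).symm
  exact ⟨this.1, this.2.1⟩

lemma PG.RM.fr2 {P : PG V} {M : Finset (V × V)} (h : P.RM M) {e : V × V} (he : e ∈ M) :
    Fr (M.erase e) e.2 := by
  intro f hf
  have := h.2 e he f (Finset.mem_of_mem_erase hf) (Finset.ne_of_mem_erase hf).symm
  exact ⟨this.2.2.1, this.2.2.2.1⟩

lemma PG.RM.nc {P : PG V} {M : Finset (V × V)} (h : P.RM M) {e : V × V} (he : e ∈ M) :
    P.NC (M.erase e) (P.col e.1 e.2) := by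
  intro f hf
  exact (h.2 e he f (Finset.mem_of_mem_erase hf) (Finset.ne_of_mem_erase hf).symm).2.2.2.2.symm

/-- Vertices covered by `M`. -/
noncomputable def VM (M : Finset (V × V)) : Finset V := M.image Prod.fst ∪ M.image Prod.snd

lemma fr_iff (M : Finset (V × V)) (v : V) : Fr M v ↔ v ∉ VM M := by
  unfold Fr VM
  simp only [Finset.mem_union, Finset.mem_image, not_or, not_exists, not_and]
  constructor
  · intro h
    exact ⟨fun e he h1 => (h e he).1 h1.symm, fun e he h1 => (h e he).2 h1.symm⟩
  · intro h e he
    exact ⟨fun h1 => h.1 e he h1.symm, fun h1 => h.2 e he h1.symm⟩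

lemma card_VM (M : Finset (V × V)) : (VM M).card ≤ 2 * M.card := by
  have h1 := Finset.card_union_le (M.image Prod.fst) (M.image Prod.snd)
  have h2 : (M.image Prod.fst).card ≤ M.card := Finset.card_image_le
  have h3 : (M.image Prod.snd).card ≤ M.card := Finset.card_image_le
  unfold VM
  omega

/-- a set of neighbors larger than the number of colors and of forbidden vertices. -/
lemma exists_good (P : PG V) (M : Finset (V × V)) (z : V) (N F : Finset V)
    (hN : ∀ w ∈ N, P.adj z w) (C : Finset ℕ) (h : F.card + C.card < N.card) :
    ∃ w ∈ N, w ∉ F ∧ P.col z w ∉ C := by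
  by_contra hcon
  push Not at hcon
  have h1 : (N \ F).card ≤ C.card := by
    apply Finset.card_le_card_of_injOn (fun w => P.col z w)
    · intro w hw
      simp only [Finset.coe_sdiff, Set.mem_sdiff, Finset.mem_coe] at hw
      exact hcon w hw.1 hw.2
    · intro w hw w' hw' hh
      simp only [Finset.coe_sdiff, Set.mem_sdiff, Finset.mem_coe] at hw hw'
      exact P.proper z w w' (hN _ hw.1) (hN _ hw'.1) hh
  have h2 := Finset.le_card_sdiff F N
  omega

noncomputable def PG.CM (P : PG V) (M : Finset (V × V)) : Finset ℕ :=
  M.image (fun e => P.col e.1 e.2)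

lemma PG.nc_iff (P : PG V) (M : Finset (V × V)) (g : ℕ) : P.NC M g ↔ g ∉ P.CM M := by
  unfold PG.NC PG.CM
  simp

lemma PG.card_CM (P : PG V) (M : Finset (V × V)) : (P.CM M).card ≤ M.card :=
  Finset.card_image_le

/-- delete a vertex -/
def PG.del (P : PG V) (x : V) : PG V where
  adj u v := P.adj u v ∧ u ≠ x ∧ v ≠ x
  col := P.col
  symm u v h := ⟨P.symm _ _ h.1, h.2.2, h.2.1⟩
  irrefl u h := P.irrefl u h.1
  colsymm := P.colsymm
  proper u v w h1 h2 := P.proper u v w h1.1 h2.1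

/-- delete a color -/
def PG.delc (P : PG V) (g : ℕ) : PG V where
  adj u v := P.adj u v ∧ P.col u v ≠ g
  col := P.col
  symm u v h := ⟨P.symm _ _ h.1, by rw [P.colsymm]; exact h.2⟩
  irrefl u h := P.irrefl u h.1
  colsymm := P.colsymm
  proper u v w h1 h2 := P.proper u v w h1.1 h2.1

variable [Fintype V]

noncomputable def PG.nb (P : PG V) (v : V) : Finset V := Finset.univ.filter (P.adj v)

lemma PG.mem_nb (P : PG V) (v w : V) : w ∈ P.nb v ↔ P.adj v w := by simp [PG.nb]

/-- the induction statement -/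
def Q (V : Type*) [Fintype V] (d : ℕ) : Prop :=
  ∀ (P : PG V) (S : Finset V), (∀ u v, P.adj u v → u ∈ S) → (∀ v ∈ S, d ≤ (P.nb v).card) →
    (d = 0 ∨ 52 * (d:ℤ) ^ 2 - 92 * d + 41 < 8 * d * S.card) →
    ∃ M, P.RM M ∧ M.card = d

lemma arith_step (k n : ℕ) (h : 52 * ((k + 1 : ℕ):ℤ) ^ 2 - 92 * ((k + 1 : ℕ):ℤ) + 41 <
    8 * ((k + 1 : ℕ):ℤ) * n) (m : ℕ) (hm : n ≤ m + 1) :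
    k = 0 ∨ 52 * (k:ℤ) ^ 2 - 92 * k + 41 < 8 * k * m := by
  rcases Nat.eq_zero_or_pos k with h0 | h0
  · exact Or.inl h0
  right
  push_cast at h
  have hm' : (n:ℤ) ≤ m + 1 := by exact_mod_cast hm
  have hk : (1:ℤ) ≤ k := by exact_mod_cast h0
  by_contra hcon
  push Not at hcon
  have h1 : 8 * ((k:ℤ) + 1) * n ≤ 8 * (k + 1) * (m + 1) := by
    apply mul_le_mul_of_nonneg_left hm'; linarith
  have h2 : (k:ℤ) * (52 * ((k:ℤ) + 1) ^ 2 - 92 * ((k:ℤ) + 1) + 41) <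
     k * (8 * (k + 1) * (m + 1)) := by
    apply mul_lt_mul_of_pos_left (by linarith); linarith
  have h3 : ((k:ℤ) + 1) * (8 * k * m) ≤ (k + 1) * (52 * (k:ℤ) ^ 2 - 92 * k + 41) := by
    apply mul_le_mul_of_nonneg_left hcon; linarith
  nlinarith

/-- maximum degree bound -/
lemma deg_le (k : ℕ) (hQ : Q V k) (P : PG V) (S : Finset V) (hS : ∀ u v, P.adj u v → u ∈ S)
    (hd : ∀ v ∈ S, k + 1 ≤ (P.nb v).card)
    (hn : 52 * ((k + 1 : ℕ):ℤ) ^ 2 - 92 * ((k + 1 : ℕ):ℤ) + 41 < 8 * ((k + 1 : ℕ):ℤ) * S.card)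
    (hno : ¬ ∃ M, P.RM M ∧ M.card = k + 1) (x : V) : (P.nb x).card ≤ 3 * k := by
  by_contra hx
  push Not at hx
  apply hno
  obtain ⟨M, hM, hMk⟩ := hQ (P.del x) (S.erase x)
    (fun u v h => Finset.mem_erase.2 ⟨h.2.1, hS u v h.1⟩)
    (by
      intro v hv
      have h1 := hd v (Finset.mem_of_mem_erase hv)
      have h2 : (P.nb v).erase x ⊆ (P.del x).nb v := by
        intro w hw
        rw [PG.mem_nb]
        exact ⟨(P.mem_nb v w).1 (Finset.mem_of_mem_erase hw), Finset.ne_of_mem_erase hv,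
          Finset.ne_of_mem_erase hw⟩
      have h3 := Finset.card_le_card h2
      have h4 := Finset.pred_card_le_card_erase (s := P.nb v) (a := x)
      omega)
    (arith_step k _ hn _ (by
      have h4 := Finset.pred_card_le_card_erase (s := S) (a := x)
      omega))
  have hM' : P.RM M := ⟨fun e he => (hM.1 e he).1, hM.2⟩
  obtain ⟨w, hw, hwF, hwC⟩ := exists_good P M x (P.nb x) (VM M)
    (fun w hw => (P.mem_nb x w).1 hw) (P.CM M) (by
      have := card_VM M; have := P.card_CM M; omega)
  have := hM'.insert ((P.mem_nb x w).1 hw) (fun e he => ⟨(hM.1 e he).2.1.symm, (hM.1 e he).2.2.symm⟩)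
    ((fr_iff M w).2 hwF) ((P.nc_iff M _).2 hwC)
  exact ⟨_, this.1, by rw [this.2, hMk]⟩

/-- color class bound -/
lemma col_le (k : ℕ) (hQ : Q V k) (P : PG V) (S : Finset V) (hS : ∀ u v, P.adj u v → u ∈ S)
    (hd : ∀ v ∈ S, k + 1 ≤ (P.nb v).card)
    (hn : 52 * ((k + 1 : ℕ):ℤ) ^ 2 - 92 * ((k + 1 : ℕ):ℤ) + 41 < 8 * ((k + 1 : ℕ):ℤ) * S.card)
    (hno : ¬ ∃ M, P.RM M ∧ M.card = k + 1) (g : ℕ) :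
    (Finset.univ.filter (fun v => ∃ u, P.adj v u ∧ P.col v u = g)).card ≤ 4 * k := by
  by_contra hx
  push Not at hx
  apply hno
  obtain ⟨M, hM, hMk⟩ := hQ (P.delc g) S
    (fun u v h => hS u v h.1)
    (by
      intro v hv
      have h1 := hd v hv
      by_contra hlt
      push Not at hlt
      obtain ⟨w, hw, hw1, hw2⟩ := exists_good P ∅ v (P.nb v) ((P.delc g).nb v)
        (fun w hw => (P.mem_nb v w).1 hw) {g} (by simp; omega) 
      apply hw1
      rw [PG.mem_nb] at *
      exact ⟨hw, by simpa using hw2⟩)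
    (arith_step k _ hn _ (by omega))
  have hM' : P.RM M := ⟨fun e he => (hM.1 e he).1, hM.2⟩
  set I := Finset.univ.filter (fun v => ∃ u, P.adj v u ∧ P.col v u = g) with hI
  have hex : ∃ v u, P.adj v u ∧ P.col v u = g ∧ v ∉ VM M ∧ u ∉ VM M := by
    by_contra hcon
    push Not at hcon
    have hp : ∀ v : V, ∃ u, v ∈ I → P.adj v u ∧ P.col v u = g := by
      intro v
      by_cases hv : v ∈ I
      · obtain ⟨u, hu⟩ := (Finset.mem_filter.1 hv).2
        exact ⟨u, fun _ => hu⟩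
      · exact ⟨v, fun h => absurd h hv⟩
    choose p hp using hp
    have h1 : (I \ VM M).card ≤ (VM M).card := by
      apply Finset.card_le_card_of_injOn p
      · intro v hv
        simp only [Finset.coe_sdiff, Set.mem_sdiff, Finset.mem_coe] at hv
        exact hcon v (p v) (hp v hv.1).1 (hp v hv.1).2 hv.2
      · intro v hv v' hv' hh
        simp only [Finset.coe_sdiff, Set.mem_sdiff, Finset.mem_coe] at hv hv'
        have a1 := hp v hv.1
        have a2 := hp v' hv'.1
        rw [← hh] at a2
        apply P.proper (p v) v v' (P.symm _ _ a1.1) (P.symm _ _ a2.1)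
        rw [P.colsymm _ v, P.colsymm _ v', a1.2, a2.2]
    have h2 := Finset.le_card_sdiff (VM M) I
    have h3 := card_VM M
    omega
  obtain ⟨v, u, h1, h2, h3, h4⟩ := hex
  have := hM'.insert h1 ((fr_iff M v).2 h3) ((fr_iff M u).2 h4)
    (fun e he => by rw [h2]; exact (hM.1 e he).2)
  exact ⟨_, this.1, by rw [this.2, hMk]⟩

/-- `x`, `y` are the two ends of `e`. -/
def En (e : V × V) (x y : V) : Prop := (x = e.1 ∧ y = e.2) ∨ (x = e.2 ∧ y = e.1)

lemma En.swap {e : V × V} {x y : V} (h : En e x y) : En e y x := by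
  unfold En at *; tauto

lemma En.fr {P : PG V} {M : Finset (V × V)} (h : P.RM M) {e : V × V} (he : e ∈ M) {x y : V}
    (hx : En e x y) : Fr (M.erase e) x := by
  rcases hx with ⟨rfl, rfl⟩ | ⟨rfl, rfl⟩
  · exact h.fr1 he
  · exact h.fr2 he

lemma En.adj {P : PG V} {M : Finset (V × V)} (h : P.RM M) {e : V × V} (he : e ∈ M) {x y : V}
    (hx : En e x y) : P.adj x y := by
  rcases hx with ⟨rfl, rfl⟩ | ⟨rfl, rfl⟩
  · exact h.1 e he
  · exact P.symm _ _ (h.1 e he)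

lemma En.col (P : PG V) {e : V × V} {x y : V}
    (hx : En e x y) : P.col x y = P.col e.1 e.2 := by
  rcases hx with ⟨rfl, rfl⟩ | ⟨rfl, rfl⟩
  · rfl
  · exact P.colsymm _ _

lemma En.ne {M : Finset (V × V)} {e : V × V} (he : e ∈ M) {x y : V}
    (hx : En e x y) {w : V} (hw : Fr M w) : w ≠ x := by
  have := hw e he
  rcases hx with ⟨rfl, rfl⟩ | ⟨rfl, rfl⟩
  · exact this.1
  · exact this.2

lemma exch_a {P : PG V} {M : Finset (V × V)} (h : P.RM M) {k : ℕ} (hk : M.card = k)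
    (hno : ¬ ∃ M, P.RM M ∧ M.card = k + 1) {u v : V} (huv : P.adj u v)
    (hu : Fr M u) (hv : Fr M v) : ¬ P.NC M (P.col u v) := by
  intro hc
  have := h.insert huv hu hv hc
  exact hno ⟨_, this.1, by rw [this.2, hk]⟩

lemma exch_b {P : PG V} {M : Finset (V × V)} (h : P.RM M) {k : ℕ} (hk : M.card = k)
    (hno : ¬ ∃ M, P.RM M ∧ M.card = k + 1) {e : V × V} (he : e ∈ M) {x y : V} (hx : En e x y)
    {u v w : V} (huv : P.adj u v) (hu : Fr M u) (hv : Fr M v) (hc : P.col u v = P.col e.1 e.2)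
    (hw : Fr M w) (hxw : P.adj x w) (hn : P.NC M (P.col x w)) (h1 : w ≠ u) (h2 : w ≠ v) :
    False := by
  obtain ⟨a1, a2⟩ := (h.erase e).insert huv (hu.erase e) (hv.erase e) (by rw [hc]; exact h.nc he)
  obtain ⟨b1, b2⟩ := a1.insert hxw ((En.fr h he hx).insert (hx.ne he hu).symm (hx.ne he hv).symm)
    ((hw.erase e).insert h1 h2) ((hn.erase e).insert (by rw [hc]; exact hn e he))
  have h0 : 0 < M.card := Finset.card_pos.2 ⟨e, he⟩
  exact hno ⟨_, b1, by rw [b2, a2, Finset.card_erase_of_mem he]; omega⟩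

lemma exch_d {P : PG V} {M : Finset (V × V)} (h : P.RM M) {k : ℕ} (hk : M.card = k)
    (hno : ¬ ∃ M, P.RM M ∧ M.card = k + 1) {e : V × V} (he : e ∈ M) {x y : V} (hx : En e x y)
    {w w' : V} (hw : Fr M w) (hxw : P.adj x w) (hn : P.NC M (P.col x w))
    (hw' : Fr M w') (hyw : P.adj y w') (hn' : P.NC M (P.col y w'))
    (h1 : w ≠ w') (h2 : P.col x w ≠ P.col y w') :
    False := by
  obtain ⟨a1, a2⟩ := (h.erase e).insert hxw (En.fr h he hx) (hw.erase e) (hn.erase e)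
  have hxy : y ≠ x := by
    rintro rfl
    exact P.irrefl _ (En.adj h he hx)
  obtain ⟨b1, b2⟩ := a1.insert hyw ((En.fr h he hx.swap).insert hxy (hx.swap.ne he hw).symm)
    ((hw'.erase e).insert (hx.ne he hw') h1.symm) ((hn'.erase e).insert h2)
  have h0 : 0 < M.card := Finset.card_pos.2 ⟨e, he⟩
  exact hno ⟨_, b1, by rw [b2, a2, Finset.card_erase_of_mem he]; omega⟩

lemma exch_e {P : PG V} {M : Finset (V × V)} (h : P.RM M) {k : ℕ} (hk : M.card = k)
    (hno : ¬ ∃ M, P.RM M ∧ M.card = k + 1) {e f : V × V} (he : e ∈ M) (hf : f ∈ M) (hef : e ≠ f)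
    {x y x' y' : V} (hx : En e x y) (hx' : En f x' y')
    {w w1 w2 : V} (hw : Fr M w) (hyw : P.adj w y') (hc : P.col w y' = P.col e.1 e.2)
    (hw1 : Fr M w1) (hxw1 : P.adj x' w1) (hn1 : P.NC M (P.col x' w1))
    (hw2 : Fr M w2) (hxw2 : P.adj x w2) (hn2 : P.NC M (P.col x w2))
    (h1 : w ≠ w1) (h2 : w ≠ w2) (h12 : w1 ≠ w2) (h3 : P.col x' w1 ≠ P.col x w2) :
    False := by
  have hfe : f ∈ M.erase e := Finset.mem_erase.2 ⟨hef.symm, hf⟩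
  have hef' : e ∈ M.erase f := Finset.mem_erase.2 ⟨hef, he⟩
  obtain ⟨a1, a2⟩ := ((h.erase e).erase f).insert hyw ((hw.erase e).erase f)
    (En.fr (h.erase e) hfe hx'.swap) (by rw [hc]; exact (h.nc he).erase f)
  have hxy : x' ≠ y' := by
    rintro rfl
    exact P.irrefl _ (En.adj h hf hx')
  have hxf : Fr (M.erase e) x := En.fr h he hx
  obtain ⟨b1, b2⟩ := a1.insert hxw1 ((En.fr (h.erase e) hfe hx').insert (hx'.ne hf hw).symm hxy)
    (((hw1.erase e).erase f).insert h1.symm (hx'.swap.ne hf hw1))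
    (((hn1.erase e).erase f).insert (by rw [hc]; exact hn1 e he))
  obtain ⟨c1, c2⟩ := b1.insert hxw2
    (((hxf.erase f).insert (hx.ne he hw).symm (hx'.swap.ne hfe hxf)).insert
      (hx'.ne hfe hxf) (hx.ne he hw1).symm)
    ((((hw2.erase e).erase f).insert h2.symm (hx'.swap.ne hf hw2)).insert (hx'.ne hf hw2) h12.symm)
    ((((hn2.erase e).erase f).insert (by rw [hc]; exact hn2 e he)).insert h3)
  have h0 : 0 < M.card := Finset.card_pos.2 ⟨e, he⟩
  have h0' : 0 < (M.erase e).card := Finset.card_pos.2 ⟨f, hfe⟩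
  have h0e := Finset.card_erase_of_mem he
  exact hno ⟨_, c1, by rw [c2, b2, a2, Finset.card_erase_of_mem hfe]; omega⟩

/-- new-colored neighbors outside `M` -/
noncomputable def PG.Nw (P : PG V) (M : Finset (V × V)) (z : V) : Finset V :=
  Finset.univ.filter (fun w => Fr M w ∧ P.adj z w ∧ P.NC M (P.col z w))

lemma PG.mem_Nw {P : PG V} {M : Finset (V × V)} {z w : V} :
    w ∈ P.Nw M z ↔ Fr M w ∧ P.adj z w ∧ P.NC M (P.col z w) := by simp [PG.Nw]

lemma Nw_zero {P : PG V} {M : Finset (V × V)} (h : P.RM M) {k : ℕ} (hk : M.card = k)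
    (hno : ¬ ∃ M, P.RM M ∧ M.card = k + 1) {e : V × V} (he : e ∈ M) {x y : V} (hx : En e x y)
    (h3 : 3 ≤ (P.Nw M x).card) : P.Nw M y = ∅ := by
  by_contra hne
  obtain ⟨w', hw'⟩ := Finset.nonempty_iff_ne_empty.2 hne
  obtain ⟨w, hw, hwF, hwC⟩ := exists_good P M x (P.Nw M x) {w'}
    (fun w hw => (PG.mem_Nw.1 hw).2.1) {P.col y w'} (by simp; omega)
  rw [PG.mem_Nw] at hw hw'
  exact exch_d h hk hno he hx hw.1 hw.2.1 hw.2.2 hw'.1 hw'.2.1 hw'.2.2 (by simpa using hwF)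
    (by simpa using hwC)

lemma no_inner {P : PG V} {M : Finset (V × V)} (h : P.RM M) {k : ℕ} (hk : M.card = k)
    (hno : ¬ ∃ M, P.RM M ∧ M.card = k + 1) {e : V × V} (he : e ∈ M) {x y : V} (hx : En e x y)
    (h3 : 3 ≤ (P.Nw M x).card) {u v : V} (huv : P.adj u v) (hu : Fr M u) (hv : Fr M v)
    (hc : P.col u v = P.col e.1 e.2) : False := by
  obtain ⟨w, hw, hwF, -⟩ := exists_good P M x (P.Nw M x) {u, v}
    (fun w hw => (PG.mem_Nw.1 hw).2.1) ∅ (by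
      have : ({u, v} : Finset V).card ≤ 2 := Finset.card_le_two
      simp only [Finset.card_empty]; omega)
  rw [PG.mem_Nw] at hw
  simp only [Finset.mem_insert, Finset.mem_singleton, not_or] at hwF
  exact exch_b h hk hno he hx huv hu hv hc hw.1 hw.2.1 hw.2.2 hwF.1 hwF.2

lemma no_Y {P : PG V} {M : Finset (V × V)} (h : P.RM M) {k : ℕ} (hk : M.card = k)
    (hno : ¬ ∃ M, P.RM M ∧ M.card = k + 1) {e f : V × V} (he : e ∈ M) (hf : f ∈ M)
    {x y x' y' : V} (hx : En e x y) (hx' : En f x' y')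
    (h4 : 4 ≤ (P.Nw M x).card) (h4' : 4 ≤ (P.Nw M x').card)
    {w : V} (hw : Fr M w) (hyw : P.adj w y') (hc : P.col w y' = P.col e.1 e.2) : False := by
  by_cases hef : e = f
  · subst hef
    have := P.proper y' w x' (P.symm _ _ hyw) (P.symm _ _ (En.adj h hf hx'))
      (by rw [P.colsymm y' w, P.colsymm y' x', hc, hx'.col])
    exact hx'.ne hf hw this
  · obtain ⟨w2, hw2, hwF2, -⟩ := exists_good P M x (P.Nw M x) {w}
      (fun w hw => (PG.mem_Nw.1 hw).2.1) ∅ (by simp; omega)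
    obtain ⟨w1, hw1, hwF1, hwC1⟩ := exists_good P M x' (P.Nw M x') {w, w2}
      (fun w hw => (PG.mem_Nw.1 hw).2.1) {P.col x w2} (by
        have : ({w, w2} : Finset V).card ≤ 2 := Finset.card_le_two
        simp only [Finset.card_singleton]; omega)
    rw [PG.mem_Nw] at hw1 hw2
    simp only [Finset.mem_insert, Finset.mem_singleton, not_or] at hwF1 hwF2 hwC1
    exact exch_e h hk hno he hf hef hx hx' hw hyw hc hw1.1 hw1.2.1 hw1.2.2 hw2.1 hw2.2.1 hw2.2.2
      (fun h => hwF1.1 h.symm) (fun h => hwF2 h.symm) hwF1.2 hwC1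

/-- vertices outside `M` incident with color `g` -/
noncomputable def PG.Dt (P : PG V) (M : Finset (V × V)) (g : ℕ) : Finset V :=
  Finset.univ.filter (fun w => Fr M w ∧ ∃ z, P.adj w z ∧ P.col w z = g)

lemma Dt_le1 {P : PG V} {M : Finset (V × V)} (h : P.RM M) {k : ℕ}
    (hC : ∀ g, (Finset.univ.filter (fun v => ∃ u, P.adj v u ∧ P.col v u = g)).card ≤ 4 * k)
    {e : V × V} (he : e ∈ M) : (P.Dt M (P.col e.1 e.2)).card + 2 ≤ 4 * k := by
  refine le_trans ?_ (hC (P.col e.1 e.2))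
  have hne : e.1 ≠ e.2 := fun hh => P.irrefl e.1 (by have := h.1 e he; rw [← hh] at this; exact this)
  rw [← Finset.card_pair hne, ← Finset.card_union_of_disjoint]
  · apply Finset.card_le_card
    intro w hw
    simp only [PG.Dt, Finset.mem_union, Finset.mem_filter, Finset.mem_univ, true_and,
      Finset.mem_insert, Finset.mem_singleton] at hw ⊢
    rcases hw with hw | rfl | rfl
    · exact hw.2
    · exact ⟨e.2, h.1 e he, rfl⟩
    · exact ⟨e.1, P.symm _ _ (h.1 e he), P.colsymm _ _⟩
  · rw [Finset.disjoint_left]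
    intro w hw hw'
    simp only [PG.Dt, Finset.mem_filter, Finset.mem_univ, true_and,
      Finset.mem_insert, Finset.mem_singleton] at hw hw'
    have := hw.1 e he
    tauto

/-- all but the part inside has partner in the rest of `M` -/
lemma Dt_le2 {P : PG V} {M : Finset (V × V)} (h : P.RM M) {k : ℕ} (hk : M.card = k)
    {e : V × V} (he : e ∈ M) (U : Finset V)
    (hU : ∀ u v, P.adj u v → Fr M u → Fr M v → P.col u v = P.col e.1 e.2 → u ∈ U) :
    (P.Dt M (P.col e.1 e.2)).card + 2 ≤ 2 * k + U.card := by
  have h1 : (P.Dt M (P.col e.1 e.2) \ U).card ≤ (VM (M.erase e)).card := by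
    have hp : ∀ v : V, ∃ u, v ∈ P.Dt M (P.col e.1 e.2) → P.adj v u ∧ P.col v u = P.col e.1 e.2 := by
      intro v
      by_cases hv : v ∈ P.Dt M (P.col e.1 e.2)
      · obtain ⟨u, hu⟩ := (Finset.mem_filter.1 hv).2.2
        exact ⟨u, fun _ => hu⟩
      · exact ⟨v, fun h => absurd h hv⟩
    choose p hp using hp
    apply Finset.card_le_card_of_injOn p
    · intro v hv
      simp only [Finset.coe_sdiff, Set.mem_sdiff, Finset.mem_coe] at hv
      have a1 := hp v hv.1
      have hvF : Fr M v := (Finset.mem_filter.1 hv.1).2.1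
      by_contra hcon
      have hcon' : Fr (M.erase e) (p v) := (fr_iff _ _).2 hcon
      apply hv.2
      apply hU v (p v) a1.1 hvF _ a1.2
      intro f hf
      by_cases hfe : f = e
      · subst hfe
        constructor
        · intro hh
          have := P.proper f.1 v f.2 (by rw [← hh]; exact P.symm _ _ a1.1) (h.1 f he)
            (by rw [P.colsymm, ← a1.2, hh])
          exact (hvF f he).2 this
        · intro hh
          have := P.proper f.2 v f.1 (by rw [← hh]; exact P.symm _ _ a1.1)
            (P.symm _ _ (h.1 f he)) (by rw [P.colsymm f.2 f.1, ← a1.2, P.colsymm, hh])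
          exact (hvF f he).1 this
      · exact hcon' f (Finset.mem_erase.2 ⟨hfe, hf⟩)
    · intro v hv v' hv' hh
      simp only [Finset.coe_sdiff, Set.mem_sdiff, Finset.mem_coe] at hv hv'
      have a1 := hp v hv.1
      have a2 := hp v' hv'.1
      rw [← hh] at a2
      apply P.proper (p v) v v' (P.symm _ _ a1.1) (P.symm _ _ a2.1)
      rw [P.colsymm _ v, P.colsymm _ v', a1.2, a2.2]
  have h2 := Finset.le_card_sdiff U (P.Dt M (P.col e.1 e.2))
  have h3 := card_VM (M.erase e)
  rw [Finset.card_erase_of_mem he] at h3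
  have h0 : 0 < M.card := Finset.card_pos.2 ⟨e, he⟩
  omega

/-- new neighbor of `x` forces few inner edges -/
lemma Dt_le3 {P : PG V} {M : Finset (V × V)} (h : P.RM M) {k : ℕ} (hk : M.card = k)
    (hno : ¬ ∃ M, P.RM M ∧ M.card = k + 1) {e : V × V} (he : e ∈ M) {x y : V} (hx : En e x y)
    {w : V} (hw : w ∈ P.Nw M x) : (P.Dt M (P.col e.1 e.2)).card ≤ 2 * k := by
  rw [PG.mem_Nw] at hw
  have key : ∀ u v, P.adj u v → Fr M u → Fr M v → P.col u v = P.col e.1 e.2 → w = u ∨ w = v := by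
    intro u v huv hu hv hc
    by_contra hcon
    push Not at hcon
    exact exch_b h hk hno he hx huv hu hv hc hw.1 hw.2.1 hw.2.2 hcon.1 hcon.2
  by_cases hex : ∃ u, P.adj w u ∧ P.col w u = P.col e.1 e.2
  · obtain ⟨u, hu1, hu2⟩ := hex
    have := Dt_le2 h hk he {w, u} (by
      intro a b hab ha hb hc
      rcases key a b hab ha hb hc with rfl | rfl
      · simp
      · have := P.proper w a u (P.symm _ _ hab) hu1 (by rw [P.colsymm, hc, hu2])
        simp [this])
    have h2 : ({w, u} : Finset V).card ≤ 2 := Finset.card_le_two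
    omega
  · have := Dt_le2 h hk he ∅ (by
      intro a b hab ha hb hc
      exfalso
      apply hex
      rcases key a b hab ha hb hc with rfl | rfl
      · exact ⟨b, hab, hc⟩
      · exact ⟨a, P.symm _ _ hab, by rw [P.colsymm, hc]⟩)
    simp at this
    omega

lemma count {P : PG V} {M : Finset (V × V)} (h : P.RM M) {k : ℕ} (hk : M.card = k)
    (hno : ¬ ∃ M, P.RM M ∧ M.card = k + 1) (W : Finset V) (hW : ∀ w ∈ W, Fr M w)
    (hWd : ∀ w ∈ W, k + 1 ≤ (P.nb w).card)
    (hD : ∀ x, (P.nb x).card ≤ 3 * k) (β : ℕ)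
    (hβ : ∀ e ∈ M, (P.Nw M e.1).card + (P.Nw M e.2).card ≤ 4 →
      (P.Nw M e.1).card + (P.Nw M e.2).card + (P.Dt M (P.col e.1 e.2)).card ≤ β) :
    ∃ a b : ℕ, a + b = k ∧ (k + 1) * W.card ≤ a * (3 * k - 1) + a * b * 2 + b * β := by
  have hor : ∀ e : V × V, ∃ q : V × V, En e q.1 q.2 ∧ (P.Nw M q.2).card ≤ (P.Nw M q.1).card := by
    intro e
    rcases le_total (P.Nw M e.2).card (P.Nw M e.1).card with hh | hh
    · exact ⟨(e.1, e.2), Or.inl ⟨rfl, rfl⟩, hh⟩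
    · exact ⟨(e.2, e.1), Or.inr ⟨rfl, rfl⟩, hh⟩
  choose q hq hqN using hor
  set B := M.filter (fun e => (P.Nw M e.1).card + (P.Nw M e.2).card ≤ 4) with hB
  set A := M.filter (fun e => ¬ (P.Nw M e.1).card + (P.Nw M e.2).card ≤ 4) with hA
  have hAM : ∀ e ∈ A, e ∈ M := fun e he => (Finset.mem_filter.1 he).1
  have hBM : ∀ e ∈ B, e ∈ M := fun e he => (Finset.mem_filter.1 he).1
  have hAB : ∀ e ∈ M, e ∈ A ∨ e ∈ B := by
    intro e he
    by_cases h' : (P.Nw M e.1).card + (P.Nw M e.2).card ≤ 4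
    · exact Or.inr (Finset.mem_filter.2 ⟨he, h'⟩)
    · exact Or.inl (Finset.mem_filter.2 ⟨he, h'⟩)
  have hA0 : ∀ e ∈ A, P.Nw M (q e).2 = ∅ ∧ 4 ≤ (P.Nw M (q e).1).card := by
    intro e he
    have h1 := (Finset.mem_filter.1 he).2
    have h2 := hqN e
    have h3 : (P.Nw M e.1).card + (P.Nw M e.2).card
        = (P.Nw M (q e).1).card + (P.Nw M (q e).2).card := by
      rcases hq e with hh | hh
      · rw [hh.1, hh.2]
      · rw [hh.1, hh.2, add_comm]
    have h4 := Nw_zero h hk hno (hAM e he) (hq e) (by omega)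
    have h5 : (P.Nw M (q e).2).card = 0 := by rw [h4]; rfl
    exact ⟨h4, by omega⟩
  refine ⟨A.card, B.card, ?_, ?_⟩
  · rw [← hk, add_comm]
    exact Finset.card_filter_add_card_filter_not _
  -- the darts
  set D : Finset (Σ _ : V, V) := W.sigma (fun w => P.nb w) with hDdef
  have hDc : (k + 1) * W.card ≤ D.card := by
    rw [hDdef, Finset.card_sigma, mul_comm, ← smul_eq_mul]
    exact Finset.card_nsmul_le_sum _ _ _ hWd
  have hDm : ∀ d ∈ D, d.1 ∈ W ∧ P.adj d.1 d.2 := by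
    intro d hd
    rw [hDdef, Finset.mem_sigma, PG.mem_nb] at hd
    exact hd
  refine hDc.trans ?_
  set T1 := A.biUnion (fun e => D.filter (fun d => d.2 = (q e).1)) with hT1
  set T3 := (A ×ˢ B).biUnion (fun ef => D.filter (fun d => P.col d.1 d.2 = P.col ef.1.1 ef.1.2 ∧
    (d.2 = ef.2.1 ∨ d.2 = ef.2.2))) with hT3
  set T2 := B.biUnion (fun e => (D.filter (fun d => d.2 = e.1 ∧ P.NC M (P.col d.1 d.2)) ∪
    D.filter (fun d => d.2 = e.2 ∧ P.NC M (P.col d.1 d.2))) ∪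
    D.filter (fun d => P.col d.1 d.2 = P.col e.1 e.2)) with hT2
  have hcov : D ⊆ (T1 ∪ T3) ∪ T2 := by
    intro d hd
    obtain ⟨hdW, hdadj⟩ := hDm d hd
    have hdF := hW _ hdW
    by_cases h1 : ∃ e ∈ A, d.2 = (q e).1
    · obtain ⟨e, he, hde⟩ := h1
      refine Finset.mem_union_left _ (Finset.mem_union_left _ ?_)
      exact Finset.mem_biUnion.2 ⟨e, he, Finset.mem_filter.2 ⟨hd, hde⟩⟩
    by_cases hB' : ∃ e ∈ B, P.col d.1 d.2 = P.col e.1 e.2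
    · obtain ⟨e, he, hde⟩ := hB'
      refine Finset.mem_union_right _ ?_
      exact Finset.mem_biUnion.2 ⟨e, he, Finset.mem_union_right _ (Finset.mem_filter.2 ⟨hd, hde⟩)⟩
    have hloc : Fr M d.2 ∨ ∃ f ∈ M, d.2 = f.1 ∨ d.2 = f.2 := by
      by_cases hf : Fr M d.2
      · exact Or.inl hf
      · right
        unfold Fr at hf
        push Not at hf
        obtain ⟨f, hf, hh⟩ := hf
        exact ⟨f, hf, by tauto⟩
    have hlocA : ∀ f ∈ A, (d.2 = f.1 ∨ d.2 = f.2) → d.2 = (q f).2 := by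
      intro f hf hh
      have hne : d.2 ≠ (q f).1 := fun h' => h1 ⟨f, hf, h'⟩
      rcases hq f with h' | h'
      · rw [h'.1] at hne; rw [h'.2]; tauto
      · rw [h'.1] at hne; rw [h'.2]; tauto
    by_cases hnew : P.NC M (P.col d.1 d.2)
    · rcases hloc with hF | ⟨f, hf, hh⟩
      · exact absurd hnew (exch_a h hk hno hdadj hdF hF)
      · rcases hAB f hf with hfA | hfB
        · exfalso
          have h2 := hlocA f hfA hh
          have h3 : d.1 ∈ P.Nw M (q f).2 := by
            rw [PG.mem_Nw, ← h2]
            exact ⟨hdF, P.symm _ _ hdadj, by rw [P.colsymm]; exact hnew⟩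
          rw [(hA0 f hfA).1] at h3
          simp at h3
        · refine Finset.mem_union_right _ ?_
          refine Finset.mem_biUnion.2 ⟨f, hfB, Finset.mem_union_left _ ?_⟩
          rcases hh with hh | hh
          · exact Finset.mem_union_left _ (Finset.mem_filter.2 ⟨hd, hh, hnew⟩)
          · exact Finset.mem_union_right _ (Finset.mem_filter.2 ⟨hd, hh, hnew⟩)
    · unfold PG.NC at hnew
      push Not at hnew
      obtain ⟨e, he, hec⟩ := hnew
      have heA : e ∈ A := by
        rcases hAB e he with h' | h'
        · exact h'
        · exact absurd ⟨e, h', hec.symm⟩ hB'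
      rcases hloc with hF | ⟨f, hf, hh⟩
      · exfalso
        have := (hA0 e heA).2
        exact no_inner h hk hno he (hq e) (by omega) hdadj hdF hF hec.symm
      · rcases hAB f hf with hfA | hfB
        · exfalso
          have h2 := hlocA f hfA hh
          exact no_Y h hk hno he hf (hq e) (hq f) (hA0 e heA).2 (hA0 f hfA).2 hdF
            (by rw [← h2]; exact hdadj) (by rw [← h2]; exact hec.symm)
        · refine Finset.mem_union_left _ (Finset.mem_union_right _ ?_)
          exact Finset.mem_biUnion.2 ⟨(e, f), Finset.mem_product.2 ⟨heA, hfB⟩,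
            Finset.mem_filter.2 ⟨hd, hec.symm, hh⟩⟩
  have hc1 : T1.card ≤ A.card * (3 * k - 1) := by
    apply Finset.card_biUnion_le_card_mul
    intro e he
    have heM := hAM e he
    have hadj := En.adj h heM (hq e)
    have h2 : (D.filter (fun d => d.2 = (q e).1)).card ≤ ((P.nb (q e).1).erase (q e).2).card := by
      apply Finset.card_le_card_of_injOn (fun d => d.1)
      · intro d hd
        rw [Finset.mem_coe, Finset.mem_filter] at hd
        obtain ⟨h1, h2⟩ := hd
        obtain ⟨h3, h4⟩ := hDm d h1
        rw [Finset.mem_coe, Finset.mem_erase, PG.mem_nb]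
        exact ⟨(hq e).swap.ne heM (hW _ h3), by rw [← h2]; exact P.symm _ _ h4⟩
      · intro d hd d' hd' hh
        rw [Finset.mem_coe, Finset.mem_filter] at hd hd'
        exact Sigma.ext hh (heq_of_eq (hd.2.trans hd'.2.symm))
    rw [Finset.card_erase_of_mem ((P.mem_nb _ _).2 hadj)] at h2
    have := hD (q e).1
    omega
  have hc3 : T3.card ≤ A.card * B.card * 2 := by
    rw [← Finset.card_product]
    apply Finset.card_biUnion_le_card_mul
    intro ef hef
    have : (D.filter (fun d => P.col d.1 d.2 = P.col ef.1.1 ef.1.2 ∧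
        (d.2 = ef.2.1 ∨ d.2 = ef.2.2))).card ≤ ({ef.2.1, ef.2.2} : Finset V).card := by
      apply Finset.card_le_card_of_injOn (fun d => d.2)
      · intro d hd
        rw [Finset.mem_coe, Finset.mem_filter] at hd
        simpa using hd.2.2
      · intro d hd d' hd' hh
        rw [Finset.mem_coe, Finset.mem_filter] at hd hd'
        have h1 := (hDm d hd.1).2
        have h2 := (hDm d' hd'.1).2
        have hh' : d.2 = d'.2 := hh
        refine Sigma.ext ?_ (heq_of_eq hh')
        apply P.proper d.2 _ _ (P.symm _ _ h1) (by rw [hh']; exact P.symm _ _ h2)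
        rw [P.colsymm, hd.2.1, P.colsymm d.2 d'.1, hh', hd'.2.1]
    exact this.trans Finset.card_le_two
  have hc2 : T2.card ≤ B.card * β := by
    apply Finset.card_biUnion_le_card_mul
    intro e he
    have heM := hBM e he
    refine le_trans ?_ (hβ e heM (Finset.mem_filter.1 he).2)
    have hN : ∀ z, (D.filter (fun d => d.2 = z ∧ P.NC M (P.col d.1 d.2))).card ≤
        (P.Nw M z).card := by
      intro z
      apply Finset.card_le_card_of_injOn (fun d => d.1)
      · intro d hd
        rw [Finset.mem_coe, Finset.mem_filter] at hd
        obtain ⟨h1, h2, h5⟩ := hd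
        obtain ⟨h3, h4⟩ := hDm d h1
        rw [Finset.mem_coe, PG.mem_Nw, ← h2]
        exact ⟨hW _ h3, P.symm _ _ h4, by rw [P.colsymm]; exact h5⟩
      · intro d hd d' hd' hh
        rw [Finset.mem_coe, Finset.mem_filter] at hd hd'
        exact Sigma.ext hh (heq_of_eq (hd.2.1.trans hd'.2.1.symm))
    have hDt : (D.filter (fun d => P.col d.1 d.2 = P.col e.1 e.2)).card ≤
        (P.Dt M (P.col e.1 e.2)).card := by
      apply Finset.card_le_card_of_injOn (fun d => d.1)
      · intro d hd
        rw [Finset.mem_coe, Finset.mem_filter] at hd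
        obtain ⟨h3, h4⟩ := hDm d hd.1
        simp only [PG.Dt, Finset.coe_filter, Finset.mem_univ, true_and, Set.mem_setOf_eq]
        exact ⟨hW _ h3, d.2, h4, hd.2⟩
      · intro d hd d' hd' hh
        rw [Finset.mem_coe, Finset.mem_filter] at hd hd'
        have hh' : d.1 = d'.1 := hh
        refine Sigma.ext hh (heq_of_eq ?_)
        apply P.proper d.1 _ _ (hDm d hd.1).2 (by rw [hh']; exact (hDm d' hd'.1).2)
        rw [hd.2, hh', hd'.2]
    refine (Finset.card_union_le _ _).trans (Nat.add_le_add ?_ hDt)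
    exact (Finset.card_union_le _ _).trans (Nat.add_le_add (hN _) (hN _))
  have := Finset.card_le_card hcov
  have := Finset.card_union_le (T1 ∪ T3) T2
  have := Finset.card_union_le T1 T3
  omega

lemma step (k : ℕ) (hQ : Q V k) : Q V (k + 1) := by
  intro P S hS hd hn
  have hn := hn.resolve_left (by omega)
  by_contra hno
  have hD := deg_le k hQ P S hS hd hn hno
  have hC := col_le k hQ P S hS hd hn hno
  obtain ⟨M, h, hk⟩ := hQ P S hS (fun v hv => by have := hd v hv; omega)
    (arith_step k _ hn _ (by omega))
  set W := S \ VM M with hWdef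
  have hW : ∀ w ∈ W, Fr M w := fun w hw => (fr_iff M w).2 (Finset.mem_sdiff.1 hw).2
  have hWd : ∀ w ∈ W, k + 1 ≤ (P.nb w).card := fun w hw => hd w (Finset.mem_sdiff.1 hw).1
  have hWc : S.card ≤ W.card + 2 * k := by
    have h1 := Finset.le_card_sdiff (VM M) S
    have h2 := card_VM M
    rw [← hWdef] at h1
    omega
  have hWn : 36 * (k:ℤ) ^ 2 - 4 * k + 1 < 8 * (k + 1) * W.card := by
    have h1 : (S.card : ℤ) ≤ W.card + 2 * k := by exact_mod_cast hWc
    push_cast at hn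
    have h2 : 8 * ((k:ℤ) + 1) * S.card ≤ 8 * (k + 1) * (W.card + 2 * k) := by
      apply mul_le_mul_of_nonneg_left h1; positivity
    nlinarith
  have hgen : ∀ e ∈ M, (P.Nw M e.1).card + (P.Nw M e.2).card ≤ 4 →
      (P.Nw M e.1).card + (P.Nw M e.2).card + (P.Dt M (P.col e.1 e.2)).card ≤
        max (4 * k - 2) (2 * k + 4) := by
    intro e he h4
    by_cases h1 : (P.Nw M e.1).Nonempty
    · obtain ⟨w, hw⟩ := h1
      have := Dt_le3 h hk hno he (Or.inl ⟨rfl, rfl⟩) hw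
      refine le_trans ?_ (le_max_right _ _)
      omega
    by_cases h2 : (P.Nw M e.2).Nonempty
    · obtain ⟨w, hw⟩ := h2
      have := Dt_le3 h hk hno he (Or.inr ⟨rfl, rfl⟩) hw
      refine le_trans ?_ (le_max_right _ _)
      omega
    rw [Finset.not_nonempty_iff_eq_empty] at h1 h2
    rw [h1, h2]
    have := Dt_le1 h hC he
    refine le_trans ?_ (le_max_left _ _)
    simp only [Finset.card_empty]
    omega
  by_cases hk1 : k = 1
  · subst hk1
    have hW3 : 3 ≤ W.card := by
      norm_num at hWn
      omega
    obtain ⟨e, rfl⟩ := Finset.card_eq_one.1 hk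
    have he : e ∈ ({e} : Finset (V × V)) := Finset.mem_singleton_self e
    obtain ⟨a, b, hab, hcnt⟩ := count h hk hno W hW hWd hD 4 (by
      intro e' he' h4
      obtain rfl := Finset.mem_singleton.1 he'
      have := Dt_le2 h hk he ∅ (by
        intro u v huv hu hv hc
        exfalso
        obtain ⟨w, hw, hwuv⟩ : ∃ w ∈ W, w ∉ ({u, v} : Finset V) := by
          apply Finset.exists_mem_notMem_of_card_lt_card
          have : ({u, v} : Finset V).card ≤ 2 := Finset.card_le_two
          omega
        obtain ⟨z, hz, -, hzc⟩ := exists_good P ∅ w (P.nb w) ∅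
          (fun z hz => (P.mem_nb _ _).1 hz) {P.col e'.1 e'.2} (by
            have := hWd w hw
            simp; omega)
        rw [PG.mem_nb] at hz
        have hzn : P.NC {e'} (P.col w z) := by
          rw [PG.nc_iff]; simpa [PG.CM] using hzc
        have hzF : ¬ Fr {e'} z := fun hF => exch_a h hk hno hz (hW w hw) hF hzn
        simp only [Finset.mem_insert, Finset.mem_singleton, not_or] at hwuv
        have hz' : z = e'.1 ∨ z = e'.2 := by
          by_contra hcon
          push Not at hcon
          exact hzF (fun f hf => by obtain rfl := Finset.mem_singleton.1 hf; exact hcon)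
        rw [P.colsymm] at hzn
        rcases hz' with rfl | rfl
        · exact exch_b h hk hno he (Or.inl ⟨rfl, rfl⟩) huv hu hv hc (hW w hw) (P.symm _ _ hz) hzn
            hwuv.1 hwuv.2
        · exact exch_b h hk hno he (Or.inr ⟨rfl, rfl⟩) huv hu hv hc (hW w hw) (P.symm _ _ hz) hzn
            hwuv.1 hwuv.2)
      simp only [Finset.card_empty] at this
      omega)
    have : a = 0 ∨ a = 1 := by omega
    rcases this with rfl | rfl
    · obtain rfl : b = 1 := by omega
      omega
    · obtain rfl : b = 0 := by omega
      omega
  obtain ⟨a, b, hab, hcnt⟩ := count h hk hno W hW hWd hD _ hgen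
  rcases Nat.lt_or_ge k 3 with hk3 | hk3
  · have : k = 0 ∨ k = 2 := by omega
    rcases this with rfl | rfl
    · obtain rfl : a = 0 := by omega
      obtain rfl : b = 0 := by omega
      norm_num at hWn hcnt
      rw [hcnt] at hWn
      simp at hWn
    · norm_num at hWn hcnt
      have hW6 : 6 ≤ W.card := by omega
      have : a = 0 ∨ a = 1 ∨ a = 2 := by omega
      rcases this with rfl | rfl | rfl
      · obtain rfl : b = 2 := by omega
        omega
      · obtain rfl : b = 1 := by omega
        omega
      · obtain rfl : b = 0 := by omega
        omega
  · rw [max_eq_left (by omega)] at hcnt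
    have h1 : 1 ≤ 3 * k := by omega
    have h2 : 2 ≤ 4 * k := by omega
    zify [h1, h2] at hcnt
    have hb : (b:ℤ) = k - a := by have : (a:ℤ) + b = k := by exact_mod_cast hab
                                  linarith
    have hk3' : (3:ℤ) ≤ k := by exact_mod_cast hk3
    rw [hb] at hcnt
    nlinarith [sq_nonneg ((k:ℤ) - 4 * a + 1)]

lemma Q_all (d : ℕ) : Q V d := by
  induction d with
  | zero =>
    intro P S _ _ _
    exact ⟨∅, ⟨by simp, by simp⟩, rfl⟩
  | succ k ih => exact step k ih

end RM

theorem rainbow_matching_of_large_order {V : Type*} [Fintype V] [DecidableEq V]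
    (G : SimpleGraph V) [DecidableRel G.Adj] (c : Sym2 V → ℕ)
    (hc : IsProperEdgeColoring G c)
    (hn : (13 : ℝ) / 2 * G.minDegree - 23 / 2 + 41 / (8 * G.minDegree)
        < (Fintype.card V : ℝ)) :
    ∃ M : Finset (Sym2 V), IsRainbowMatching G c M ∧ M.card = G.minDegree := by
  let P : PG V :=
    { adj := G.Adj
      col := fun u v => c s(u, v)
      symm := fun u v h => h.symm
      irrefl := fun u h => G.irrefl h
      colsymm := fun u v => by rw [Sym2.eq_swap]
      proper := by
        intro u v w h1 h2 h3
        by_contra hne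
        refine hc s(u, v) h1 s(u, w) h2 ?_ ⟨u, by simp, by simp⟩ h3
        intro h
        rw [Sym2.congr_right] at h
        exact hne h }
  obtain ⟨M, hM, hMk⟩ := Q_all (V := V) G.minDegree P Finset.univ (fun _ _ _ => Finset.mem_univ _)
    (by
      intro v _
      refine (G.minDegree_le_degree v).trans (le_of_eq ?_)
      rw [← SimpleGraph.card_neighborFinset_eq_degree]
      congr 1
      ext w
      rw [PG.mem_nb, SimpleGraph.mem_neighborFinset])
    (by
      rcases Nat.eq_zero_or_pos G.minDegree with h0 | h0
      · exact Or.inl h0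
      right
      rw [Finset.card_univ]
      have hd : (0:ℝ) < G.minDegree := by exact_mod_cast h0
      have h1 := mul_lt_mul_of_pos_left hn (by positivity : (0:ℝ) < 8 * G.minDegree)
      have h2 : 8 * (G.minDegree:ℝ) * ((13 : ℝ) / 2 * G.minDegree - 23 / 2 + 41 / (8 * G.minDegree))
          = 52 * (G.minDegree:ℝ) ^ 2 - 92 * G.minDegree + 41 := by
        field_simp
        ring
      rw [h2] at h1
      exact_mod_cast h1)
  have hinj : Set.InjOn (fun e : V × V => s(e.1, e.2)) (M : Set (V × V)) := by
    intro e he f hf hh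
    by_contra hne
    have := hM.2 e he f hf hne
    simp only [Sym2.eq_iff] at hh
    tauto
  refine ⟨M.image (fun e => s(e.1, e.2)), ⟨?_, ?_, ?_⟩, ?_⟩
  · intro s hs
    simp only [Finset.coe_image, Set.mem_image, Finset.mem_coe] at hs
    obtain ⟨e, he, rfl⟩ := hs
    exact hM.1 e he
  · intro s hs t ht hst v hv hv'
    simp only [Finset.coe_image, Set.mem_image, Finset.mem_coe] at hs ht
    obtain ⟨e, he, rfl⟩ := hs
    obtain ⟨f, hf, rfl⟩ := ht
    have hne : e ≠ f := by rintro rfl; exact hst rfl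
    have := hM.2 e he f hf hne
    simp only [Sym2.mem_iff] at hv hv'
    rcases hv with rfl | rfl <;> tauto
  · intro s hs t ht hst
    simp only [Finset.coe_image, Set.mem_image, Finset.mem_coe] at hs ht
    obtain ⟨e, he, rfl⟩ := hs
    obtain ⟨f, hf, rfl⟩ := ht
    by_contra hne'
    have hne : e ≠ f := by rintro rfl; exact hne' rfl
    exact (hM.2 e he f hf hne).2.2.2.2 hst
  · rw [Finset.card_image_of_injOn hinj, hMk]
end

section
/- If G is a triangle-free properly edge-colored graph with minimum degree δ and more than (49/8)δ − 21/2 + 9/(2δ) vertices, then G contains a rainbow matching of size δ. -/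
open SimpleGraph

/-- Rainbow matching living in the vertex set `U`. -/
structure RbM {V : Type*} (G : SimpleGraph V) (c : Sym2 V → ℕ) (U : Finset V)
    (M : Finset (Sym2 V)) : Prop where
  adj : ∀ e ∈ M, e ∈ G.edgeSet
  inU : ∀ e ∈ M, ∀ v ∈ e, v ∈ U
  disj : ∀ e ∈ M, ∀ f ∈ M, ∀ v, v ∈ e → v ∈ f → e = f
  inj : ∀ e ∈ M, ∀ f ∈ M, c e = c f → e = f

theorem RbM.subset {V : Type*} {G : SimpleGraph V} {c : Sym2 V → ℕ} {U : Finset V}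
    {M N : Finset (Sym2 V)} (h : RbM G c U M) (hN : N ⊆ M) : RbM G c U N :=
  ⟨fun e he => h.adj e (hN he), fun e he => h.inU e (hN he),
   fun e he f hf => h.disj e (hN he) f (hN hf), fun e he f hf => h.inj e (hN he) f (hN hf)⟩

theorem RbM.ins {V : Type*} [DecidableEq V] {G : SimpleGraph V} {c : Sym2 V → ℕ} {U : Finset V}
    {M : Finset (Sym2 V)} (h : RbM G c U M) {u v : V} (hu : u ∈ U) (hv : v ∈ U)
    (huv : G.Adj u v) (hu' : ∀ e ∈ M, u ∉ e) (hv' : ∀ e ∈ M, v ∉ e)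
    (hcol : ∀ e ∈ M, c e ≠ c s(u, v)) :
    RbM G c U (insert s(u, v) M) ∧ (insert s(u, v) M).card = M.card + 1 := by
  have hnot : s(u, v) ∉ M := fun hm => hu' _ hm (by simp)
  refine ⟨⟨?_, ?_, ?_, ?_⟩, Finset.card_insert_of_notMem hnot⟩
  · intro e he
    rcases Finset.mem_insert.1 he with rfl | he
    · exact huv
    · exact h.adj e he
  · intro e he w hw
    rcases Finset.mem_insert.1 he with rfl | he
    · rcases Sym2.mem_iff.1 hw with rfl | rfl <;> assumption
    · exact h.inU e he w hw
  · intro e he f hf w hwe hwf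
    rcases Finset.mem_insert.1 he with rfl | he' <;> rcases Finset.mem_insert.1 hf with rfl | hf'
    · rfl
    · rcases Sym2.mem_iff.1 hwe with rfl | rfl
      · exact absurd hwf (hu' f hf')
      · exact absurd hwf (hv' f hf')
    · rcases Sym2.mem_iff.1 hwf with rfl | rfl
      · exact absurd hwe (hu' e he')
      · exact absurd hwe (hv' e he')
    · exact h.disj e he' f hf' w hwe hwf
  · intro e he f hf hef
    rcases Finset.mem_insert.1 he with rfl | he <;> rcases Finset.mem_insert.1 hf with rfl | hf
    · rfl
    · exact absurd hef.symm (hcol f hf)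
    · exact absurd hef (hcol e he)
    · exact h.inj e he f hf hef

/-- Local form of properness. -/
def PropC {V : Type*} (G : SimpleGraph V) (c : Sym2 V → ℕ) : Prop :=
  ∀ u v w, G.Adj u v → G.Adj u w → c s(u, v) = c s(u, w) → v = w

open Classical in
theorem card_cover_le {V : Type*} (U : Finset V) (M : Finset (Sym2 V)) :
    (U.filter (fun v => ∃ e ∈ M, v ∈ e)).card ≤ 2 * M.card := by
  have : U.filter (fun v => ∃ e ∈ M, v ∈ e) ⊆ M.biUnion (fun e => e.toFinset) := by
    intro v hv
    simp only [Finset.mem_filter, Finset.mem_biUnion, Sym2.mem_toFinset] at hv ⊢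
    exact hv.2
  refine (Finset.card_le_card this).trans ?_
  rw [mul_comm]
  refine Finset.card_biUnion_le_card_mul _ _ _ ?_
  intro e _
  induction e with
  | h x y => rw [Sym2.toFinset_mk_eq]; exact Finset.card_le_two

open Classical in
theorem card_col_le {V : Type*} {G : SimpleGraph V} {c : Sym2 V → ℕ} (hp : PropC G c)
    (U : Finset V) (K : Finset (Sym2 V)) (v : V) :
    (U.filter (fun w => G.Adj v w ∧ ∃ e ∈ K, c e = c s(v, w))).card ≤ K.card := by
  refine le_trans ?_ (Finset.card_image_le (s := K) (f := c))
  refine Finset.card_le_card_of_injOn (fun w => c s(v, w)) ?_ ?_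
  · intro w hw
    simp only [Finset.coe_filter, Set.mem_ofPred_eq, Finset.coe_image] at hw ⊢
    obtain ⟨_, _, e, he, h⟩ := hw
    exact ⟨e, he, h⟩
  · intro w hw w' hw' h
    simp only [Finset.coe_filter, Set.mem_ofPred_eq] at hw hw'
    exact hp v w w' hw.2.1 hw'.2.1 h

/-- The order bound. -/
def rbOrd : ℕ → ℕ
  | 0 => 0
  | 1 => 1
  | 2 => 5
  | (n + 3) => 6 * n + 10

theorem rbOrd_succ (m : ℕ) : rbOrd m + 1 ≤ rbOrd (m + 1) := by
  match m with
  | 0 => simp [rbOrd]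
  | 1 => simp [rbOrd]
  | 2 => simp [rbOrd]
  | (n + 3) => simp only [rbOrd]; omega

open Classical in
/-- Induction predicate. -/
def RbP (V : Type*) (c : Sym2 V → ℕ) (k : ℕ) : Prop :=
  ∀ (G : SimpleGraph V) (U : Finset V), PropC G c →
    (∀ x y z, G.Adj x y → G.Adj y z → G.Adj x z → False) →
    (∀ v ∈ U, k ≤ (U.filter (fun w => G.Adj v w)).card) → rbOrd k ≤ U.card →
    ∃ M, RbM G c U M ∧ M.card = k

open Classical in
theorem deg_bound {V : Type*} {c : Sym2 V → ℕ} {m : ℕ} (ih : RbP V c m)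
    {G : SimpleGraph V} {U : Finset V} (hp : PropC G c)
    (ht : ∀ x y z, G.Adj x y → G.Adj y z → G.Adj x z → False)
    (hd : ∀ v ∈ U, m + 1 ≤ (U.filter (fun w => G.Adj v w)).card) (hU : rbOrd (m + 1) ≤ U.card)
    (hno : ∀ M, RbM G c U M → M.card ≤ m) (x : V) (hx : x ∈ U) :
    (U.filter (fun w => G.Adj x w)).card ≤ 3 * m := by
  obtain ⟨M, hM, hMc⟩ := ih G (U.erase x) hp ht (by
    intro v hv
    have h1 := hd v (Finset.mem_of_mem_erase hv)
    have h2 : (U.erase x).filter (fun w => G.Adj v w) = (U.filter (fun w => G.Adj v w)).erase x := by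
      ext w; simp only [Finset.mem_filter, Finset.mem_erase]; tauto
    rw [h2]
    have := Finset.pred_card_le_card_erase (s := U.filter (fun w => G.Adj v w)) (a := x)
    omega) (by
    have := rbOrd_succ m
    rw [Finset.card_erase_of_mem hx]; omega)
  have hMU : RbM G c U M := ⟨hM.adj, fun e he v hv => Finset.mem_of_mem_erase (hM.inU e he v hv),
    hM.disj, hM.inj⟩
  have hsub : U.filter (fun w => G.Adj x w) ⊆ U.filter (fun v => ∃ e ∈ M, v ∈ e) ∪
      U.filter (fun w => G.Adj x w ∧ ∃ e ∈ M, c e = c s(x, w)) := by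
    intro w hw
    simp only [Finset.mem_filter, Finset.mem_union] at hw ⊢
    by_contra hcon
    push Not at hcon
    have := hMU.ins hx hw.1 hw.2 (fun e he hxe => by
      have := hM.inU e he x hxe
      simp at this) (hcon.1 hw.1) (hcon.2 hw.1 hw.2)
    have h2 := hno _ this.1
    omega
  have h1 := Finset.card_le_card hsub
  have h2 := Finset.card_union_le (U.filter (fun v => ∃ e ∈ M, v ∈ e))
      (U.filter (fun w => G.Adj x w ∧ ∃ e ∈ M, c e = c s(x, w)))
  have h3 := card_cover_le U M
  have h4 := card_col_le hp U M x
  omega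

open Classical in
theorem col_bound {V : Type*} {c : Sym2 V → ℕ} {m : ℕ} (ih : RbP V c m)
    {G : SimpleGraph V} {U : Finset V} (hp : PropC G c)
    (ht : ∀ x y z, G.Adj x y → G.Adj y z → G.Adj x z → False)
    (hd : ∀ v ∈ U, m + 1 ≤ (U.filter (fun w => G.Adj v w)).card) (hU : rbOrd (m + 1) ≤ U.card)
    (hno : ∀ M, RbM G c U M → M.card ≤ m) (q : ℕ) :
    ((U ×ˢ U).filter (fun p => G.Adj p.1 p.2 ∧ c s(p.1, p.2) = q)).card ≤ 4 * m := by
  have hle : ∀ u v, (G.deleteEdges {e | c e = q}).Adj u v → G.Adj u v ∧ c s(u, v) ≠ q := by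
    intro u v h
    rw [SimpleGraph.deleteEdges_adj] at h
    exact h
  obtain ⟨M, hM, hMc⟩ := ih (G.deleteEdges {e | c e = q}) U
    (fun u v w h1 h2 => hp u v w (hle _ _ h1).1 (hle _ _ h2).1)
    (fun x y z h1 h2 h3 => ht x y z (hle _ _ h1).1 (hle _ _ h2).1 (hle _ _ h3).1) (by
    intro v hv
    have h1 := hd v hv
    have hs : U.filter (fun w => G.Adj v w) ⊆
        U.filter (fun w => (G.deleteEdges {e | c e = q}).Adj v w) ∪
        U.filter (fun w => G.Adj v w ∧ c s(v, w) = q) := by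
      intro w hw
      simp only [Finset.mem_filter, Finset.mem_union, SimpleGraph.deleteEdges_adj,
        Set.mem_ofPred_eq] at hw ⊢
      tauto
    have h2 := (Finset.card_le_card hs).trans (Finset.card_union_le _ _)
    have h3 : (U.filter (fun w => G.Adj v w ∧ c s(v, w) = q)).card ≤ 1 := by
      rw [Finset.card_le_one]
      intro a ha b hb
      simp only [Finset.mem_filter] at ha hb
      exact hp v a b ha.2.1 hb.2.1 (ha.2.2.trans hb.2.2.symm)
    have h4 : m ≤ (U.filter (fun w => (G.deleteEdges {e | c e = q}).Adj v w)).card := by omega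
    convert h4) (by have := rbOrd_succ m; omega)
  have hMU : RbM G c U M := ⟨fun e he => by
      have := hM.adj e he
      rw [SimpleGraph.edgeSet_deleteEdges] at this
      exact this.1, hM.inU, hM.disj, hM.inj⟩
  have hMq : ∀ e ∈ M, c e ≠ q := fun e he => by
    have := hM.adj e he
    rw [SimpleGraph.edgeSet_deleteEdges] at this
    exact this.2
  set X := U.filter (fun v => ∃ e ∈ M, v ∈ e) with hX
  set P := (U ×ˢ U).filter (fun p => G.Adj p.1 p.2 ∧ c s(p.1, p.2) = q) with hP
  have hsub : P ⊆ P.filter (fun p => p.1 ∈ X) ∪ P.filter (fun p => p.2 ∈ X) := by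
    intro p hpP
    have hpP' := hpP
    simp only [hP, Finset.mem_filter, Finset.mem_product] at hpP'
    simp only [Finset.mem_filter, Finset.mem_union, hpP, true_and, hX, hpP'.1.1, hpP'.1.2]
    by_contra hcon
    push Not at hcon
    have := hMU.ins hpP'.1.1 hpP'.1.2 hpP'.2.1 hcon.1 hcon.2
      (fun e he => by rw [hpP'.2.2]; exact hMq e he)
    have h2 := hno _ this.1
    omega
  have h1 : (P.filter (fun p => p.1 ∈ X)).card ≤ X.card := by
    refine Finset.card_le_card_of_injOn Prod.fst ?_ ?_
    · intro p hh; simp at hh; exact hh.2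
    · intro p h p' h' hh
      simp only [hP, Finset.coe_filter, Set.mem_ofPred_eq, Finset.mem_filter] at h h'
      refine Prod.ext hh (hp p.1 _ _ h.1.2.1 ?_ ?_)
      · rw [hh]; exact h'.1.2.1
      · rw [h.1.2.2, hh, h'.1.2.2]
  have h2 : (P.filter (fun p => p.2 ∈ X)).card ≤ X.card := by
    refine Finset.card_le_card_of_injOn Prod.snd ?_ ?_
    · intro p hh; simp at hh; exact hh.2
    · intro p h p' h' hh
      simp only [hP, Finset.coe_filter, Set.mem_ofPred_eq, Finset.mem_filter] at h h'
      refine Prod.ext (hp p.2 _ _ h.1.2.1.symm ?_ ?_) hh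
      · rw [hh]; exact h'.1.2.1.symm
      · rw [Sym2.eq_swap, h.1.2.2, hh, Sym2.eq_swap, h'.1.2.2]
  have h3 : X.card ≤ 2 * M.card := by
    have h := card_cover_le U M
    convert h
  have h4 := (Finset.card_le_card hsub).trans (Finset.card_union_le _ _)
  omega

open Classical in
theorem step_small {V : Type*} {c : Sym2 V → ℕ} (ih : RbP V c 1)
    {G : SimpleGraph V} {U : Finset V} (hp : PropC G c)
    (ht : ∀ x y z, G.Adj x y → G.Adj y z → G.Adj x z → False)
    (hd : ∀ v ∈ U, 1 + 1 ≤ (U.filter (fun w => G.Adj v w)).card) (hU : rbOrd (1 + 1) ≤ U.card)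
    (hno : ∀ M, RbM G c U M → M.card ≤ 1) : False := by
  have hU5 : 5 ≤ U.card := hU
  obtain ⟨x, hx⟩ : U.Nonempty := by rw [← Finset.card_pos]; omega
  obtain ⟨y, hy⟩ : (U.filter (fun w => G.Adj x w)).Nonempty := by
    rw [← Finset.card_pos]; have := hd x hx; omega
  rw [Finset.mem_filter] at hy
  have hM0 : RbM G c U ∅ := ⟨by simp, by simp, by simp, by simp⟩
  obtain ⟨hM, hMc⟩ := hM0.ins hx hy.1 hy.2 (by simp) (by simp) (by simp)
  have hb := col_bound ih hp ht hd hU hno (c s(x, y))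
  have : U.card ≤ 4 := by
    refine le_trans ?_ hb
    refine le_trans (Finset.card_le_card ?_) (Finset.card_image_le (f := Prod.fst))
    intro w hw
    simp only [Finset.mem_image, Finset.mem_filter, Finset.mem_product]
    suffices h : ∃ z ∈ U, G.Adj w z ∧ c s(w, z) = c s(x, y) by
      obtain ⟨z, hz, h1, h2⟩ := h
      exact ⟨(w, z), ⟨⟨hw, hz⟩, h1, h2⟩, rfl⟩
    by_cases hwx : w = x
    · subst hwx; exact ⟨y, hy.1, hy.2, rfl⟩
    by_cases hwy : w = y
    · subst hwy; exact ⟨x, hx, hy.2.symm, by rw [Sym2.eq_swap]⟩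
    obtain ⟨a, ha, b, hb, hab⟩ := Finset.one_lt_card.1 (hd w hw)
    rw [Finset.mem_filter] at ha hb
    have key : ∀ z ∈ U, G.Adj w z → z ≠ x → z ≠ y → c s(w, z) = c s(x, y) := by
      intro z hz hwz h1 h2
      by_contra hne
      have := hM.ins hw hz hwz (by simp [hwx, hwy]) (by simp [h1, h2])
        (by simpa using Ne.symm hne)
      have h3 := hno _ this.1
      omega
    have hnot : ¬ (G.Adj w x ∧ G.Adj w y) := fun h => ht w x y h.1 hy.2 h.2
    have hz : ∃ z ∈ U, G.Adj w z ∧ z ≠ x ∧ z ≠ y := by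
      by_contra hcon
      push Not at hcon
      have h1 := hcon a ha.1 ha.2
      have h2 := hcon b hb.1 hb.2
      by_cases hax : a = x
      · have hby := h2 (fun h => hab (hax.trans h.symm))
        exact hnot ⟨hax ▸ ha.2, hby ▸ hb.2⟩
      · have hay := h1 hax
        have hbx : b = x := by
          by_contra h
          exact hab (hay.trans (h2 h).symm)
        exact hnot ⟨hbx ▸ hb.2, hay ▸ ha.2⟩
    obtain ⟨z, h1, h2, h3, h4⟩ := hz
    exact ⟨z, h1, h2, key z h1 h2 h3 h4⟩
  omega

open Classical in
theorem RbM.add2 {V : Type*} {G : SimpleGraph V} {c : Sym2 V → ℕ} {U : Finset V}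
    {M : Finset (Sym2 V)} (h : RbM G c U M) {a b x y : V} (ha : a ∈ U) (hb : b ∈ U)
    (hx : x ∈ U) (hy : y ∈ U) (hab : G.Adj a b) (hxy : G.Adj x y)
    (ha' : ∀ e ∈ M, a ∉ e) (hb' : ∀ e ∈ M, b ∉ e)
    (hx' : ∀ e ∈ M, x ∉ e) (hy' : ∀ e ∈ M, y ∉ e)
    (hax : a ≠ x) (hay : a ≠ y) (hbx : b ≠ x) (hby : b ≠ y)
    (hcol : ∀ e ∈ M, c e ≠ c s(a, b)) (hcol' : ∀ e ∈ M, c e ≠ c s(x, y))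
    (hne : c s(a, b) ≠ c s(x, y)) :
    ∃ N, RbM G c U N ∧ N.card = M.card + 2 := by
  obtain ⟨h1, h2⟩ := h.ins ha hb hab ha' hb' hcol
  obtain ⟨h3, h4⟩ := h1.ins hx hy hxy
    (by
      intro e he
      rcases Finset.mem_insert.1 he with rfl | he
      · simp [hax.symm, hbx.symm]
      · exact hx' e he)
    (by
      intro e he
      rcases Finset.mem_insert.1 he with rfl | he
      · simp [hay.symm, hby.symm]
      · exact hy' e he)
    (by
      intro e he
      rcases Finset.mem_insert.1 he with rfl | he
      · exact hne
      · exact hcol' e he)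
  exact ⟨_, h3, by omega⟩

open Classical in
theorem RbM.add3 {V : Type*} {G : SimpleGraph V} {c : Sym2 V → ℕ} {U : Finset V}
    {M : Finset (Sym2 V)} (h : RbM G c U M) {u v a b x y : V}
    (hu : u ∈ U) (hv : v ∈ U) (ha : a ∈ U) (hb : b ∈ U)
    (hx : x ∈ U) (hy : y ∈ U) (huv : G.Adj u v) (hab : G.Adj a b) (hxy : G.Adj x y)
    (hu' : ∀ e ∈ M, u ∉ e) (hv' : ∀ e ∈ M, v ∉ e)
    (ha' : ∀ e ∈ M, a ∉ e) (hb' : ∀ e ∈ M, b ∉ e)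
    (hx' : ∀ e ∈ M, x ∉ e) (hy' : ∀ e ∈ M, y ∉ e)
    (hua : u ≠ a) (hub : u ≠ b) (hux : u ≠ x) (huy : u ≠ y)
    (hva : v ≠ a) (hvb : v ≠ b) (hvx : v ≠ x) (hvy : v ≠ y)
    (hax : a ≠ x) (hay : a ≠ y) (hbx : b ≠ x) (hby : b ≠ y)
    (hcol0 : ∀ e ∈ M, c e ≠ c s(u, v))
    (hcol : ∀ e ∈ M, c e ≠ c s(a, b)) (hcol' : ∀ e ∈ M, c e ≠ c s(x, y))
    (hn1 : c s(u, v) ≠ c s(a, b)) (hn2 : c s(u, v) ≠ c s(x, y))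
    (hne : c s(a, b) ≠ c s(x, y)) :
    ∃ N, RbM G c U N ∧ N.card = M.card + 3 := by
  obtain ⟨h1, h2⟩ := h.ins hu hv huv hu' hv' hcol0
  have key : ∀ z, u ≠ z → v ≠ z → (∀ e ∈ M, z ∉ e) → ∀ e ∈ insert s(u, v) M, z ∉ e := by
    intro z hz1 hz2 hz e he
    rcases Finset.mem_insert.1 he with rfl | he
    · simp [hz1.symm, hz2.symm]
    · exact hz e he
  have key2 : ∀ q, c s(u, v) ≠ q → (∀ e ∈ M, c e ≠ q) → ∀ e ∈ insert s(u, v) M, c e ≠ q := by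
    intro z hz1 hz e he
    rcases Finset.mem_insert.1 he with rfl | he
    · exact hz1
    · exact hz e he
  obtain ⟨N, hN, hN'⟩ := h1.add2 ha hb hx hy hab hxy (key a hua hva ha') (key b hub hvb hb')
    (key x hux hvx hx') (key y huy hvy hy') hax hay hbx hby (key2 _ hn1 hcol) (key2 _ hn2 hcol') hne
  exact ⟨N, hN, by omega⟩

open Classical in
/-- Uncovered vertices. -/
noncomputable def rbW {V : Type*} (U : Finset V) (M : Finset (Sym2 V)) : Finset V :=
  U.filter (fun v => ∀ e ∈ M, v ∉ e)

open Classical in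
/-- Uncovered neighbours along new colors. -/
noncomputable def rbNew {V : Type*} (G : SimpleGraph V) (c : Sym2 V → ℕ) (U : Finset V)
    (M : Finset (Sym2 V)) (v : V) : Finset V :=
  (rbW U M).filter (fun w => G.Adj v w ∧ ∀ e ∈ M, c e ≠ c s(v, w))

/-- The color of `e` occurs robustly among the uncovered vertices. -/
def rbB {V : Type*} (G : SimpleGraph V) (c : Sym2 V → ℕ) (U : Finset V)
    (M : Finset (Sym2 V)) (e : Sym2 V) : Prop :=
  ∀ w, ∃ p q, p ∈ rbW U M ∧ q ∈ rbW U M ∧ G.Adj p q ∧ c s(p, q) = c e ∧ p ≠ w ∧ q ≠ w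

/-- Some endpoint of `e` has many new colored edges to uncovered vertices. -/
def rbA {V : Type*} (G : SimpleGraph V) (c : Sym2 V → ℕ) (U : Finset V)
    (M : Finset (Sym2 V)) (e : Sym2 V) : Prop :=
  ∃ x ∈ e, 4 ≤ (rbNew G c U M x).card

theorem mem_rbW {V : Type*} {U : Finset V} {M : Finset (Sym2 V)} {v : V} :
    v ∈ rbW U M ↔ v ∈ U ∧ ∀ e ∈ M, v ∉ e := by
  simp [rbW]

theorem mem_rbNew {V : Type*} {G : SimpleGraph V} {c : Sym2 V → ℕ} {U : Finset V}
    {M : Finset (Sym2 V)} {v w : V} :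
    w ∈ rbNew G c U M v ↔ w ∈ rbW U M ∧ G.Adj v w ∧ ∀ e ∈ M, c e ≠ c s(v, w) := by
  simp [rbNew]

section facts
variable {V : Type*} {G : SimpleGraph V} {c : Sym2 V → ℕ} {U : Finset V}
    {M : Finset (Sym2 V)}

theorem fact1 (hM : RbM G c U M) (hno : ∀ N, RbM G c U N → N.card ≤ M.card) {u v : V}
    (hu : u ∈ rbW U M) (hv : v ∈ rbW U M) (huv : G.Adj u v) : ∃ e ∈ M, c e = c s(u, v) := by
  classical
  by_contra hcon
  push Not at hcon
  rw [mem_rbW] at hu hv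
  have := hM.ins hu.1 hv.1 huv hu.2 hv.2 hcon
  have h2 := hno _ this.1
  omega

theorem ne_of_W {e : Sym2 V} (he : e ∈ M) {v w : V} (hv : v ∈ e) (hw : w ∈ rbW U M) : v ≠ w := by
  rintro rfl
  exact (mem_rbW.1 hw).2 e he hv

/-- Replace `e` by two edges: one uncovered of the color of `e`, one new colored at `e`. -/
theorem swap1 (hM : RbM G c U M) (hno : ∀ N, RbM G c U N → N.card ≤ M.card) {e : Sym2 V}
    (he : e ∈ M) {v w p q : V} (hv : v ∈ e) (hw : w ∈ rbNew G c U M v)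
    (hp : p ∈ rbW U M) (hq : q ∈ rbW U M) (hpq : G.Adj p q) (hc : c s(p, q) = c e)
    (hpw : p ≠ w) (hqw : q ≠ w) : False := by
  classical
  rw [mem_rbNew] at hw
  have hvp := ne_of_W he hv hp
  have hvq := ne_of_W he hv hq
  have hvU := hM.inU e he v hv
  have hM' : RbM G c U (M.erase e) := hM.subset (Finset.erase_subset _ _)
  have hWp := mem_rbW.1 hp
  have hWq := mem_rbW.1 hq
  have hWw := mem_rbW.1 hw.1
  obtain ⟨N, hN, hNc⟩ := hM'.add2 hWp.1 hWq.1 hvU hWw.1 hpq hw.2.1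
    (fun f hf => hWp.2 f (Finset.mem_of_mem_erase hf))
    (fun f hf => hWq.2 f (Finset.mem_of_mem_erase hf))
    (fun f hf hvf => (Finset.mem_erase.1 hf).1 (hM.disj f (Finset.mem_of_mem_erase hf) e he v hvf hv))
    (fun f hf => hWw.2 f (Finset.mem_of_mem_erase hf))
    hvp.symm hpw hvq.symm hqw
    (fun f hf hcf => (Finset.mem_erase.1 hf).1
      (hM.inj f (Finset.mem_of_mem_erase hf) e he (hcf.trans hc)))
    (fun f hf => hw.2.2 f (Finset.mem_of_mem_erase hf))
    (by rw [hc]; exact hw.2.2 e he)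
  have h1 := hno N hN
  have h2 := Finset.card_erase_add_one he
  omega

theorem fact2 (hM : RbM G c U M) (hno : ∀ N, RbM G c U N → N.card ≤ M.card) {e : Sym2 V}
    (he : e ∈ M) (hB : rbB G c U M e) {v w : V} (hv : v ∈ e) (hw : w ∈ rbNew G c U M v) :
    False := by
  obtain ⟨p, q, hp, hq, hpq, hc, h1, h2⟩ := hB w
  exact swap1 hM hno he hv hw hp hq hpq hc h1 h2

theorem fact3 (hpr : PropC G c) (hM : RbM G c U M) (hno : ∀ N, RbM G c U N → N.card ≤ M.card)
    {x y : V} (he : s(x, y) ∈ M) (h3 : 3 ≤ (rbNew G c U M x).card) : rbNew G c U M y = ∅ := by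
  classical
  rw [Finset.eq_empty_iff_forall_notMem]
  intro w hw
  have hxy : x ≠ y := (hM.adj _ he : G.Adj x y).ne
  obtain ⟨z, hz, hzw, hzc⟩ : ∃ z ∈ rbNew G c U M x, z ≠ w ∧ c s(x, z) ≠ c s(y, w) := by
    by_contra hcon
    push Not at hcon
    have hs : rbNew G c U M x ⊆ {w} ∪
        (rbNew G c U M x).filter (fun z => c s(x, z) = c s(y, w)) := by
      intro z hz
      by_cases hzw : z = w
      · simp [hzw]
      · simp [hz, hcon z hz hzw]
    have h4 := (Finset.card_le_card hs).trans (Finset.card_union_le _ _)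
    have h5 : ((rbNew G c U M x).filter (fun z => c s(x, z) = c s(y, w))).card ≤ 1 := by
      rw [Finset.card_le_one]
      intro a ha b hb
      rw [Finset.mem_filter, mem_rbNew] at ha hb
      exact hpr x a b ha.1.2.1 hb.1.2.1 (ha.2.trans hb.2.symm)
    rw [Finset.card_singleton] at h4
    omega
  rw [mem_rbNew] at hw hz
  have hx : x ∈ s(x, y) := by simp
  have hy : y ∈ s(x, y) := by simp
  have hM' : RbM G c U (M.erase s(x, y)) := hM.subset (Finset.erase_subset _ _)
  have hWz := mem_rbW.1 hz.1
  have hWw := mem_rbW.1 hw.1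
  obtain ⟨N, hN, hNc⟩ := hM'.add2 (hM.inU _ he x hx) hWz.1 (hM.inU _ he y hy) hWw.1 hz.2.1 hw.2.1
    (fun f hf hvf => (Finset.mem_erase.1 hf).1
      (hM.disj f (Finset.mem_of_mem_erase hf) _ he x hvf hx))
    (fun f hf => hWz.2 f (Finset.mem_of_mem_erase hf))
    (fun f hf hvf => (Finset.mem_erase.1 hf).1
      (hM.disj f (Finset.mem_of_mem_erase hf) _ he y hvf hy))
    (fun f hf => hWw.2 f (Finset.mem_of_mem_erase hf))
    hxy (ne_of_W he hx hw.1) (ne_of_W he hy hz.1).symm hzw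
    (fun f hf => hz.2.2 f (Finset.mem_of_mem_erase hf))
    (fun f hf => hw.2.2 f (Finset.mem_of_mem_erase hf)) hzc
  have h1 := hno N hN
  have h2 := Finset.card_erase_add_one he
  omega

theorem avoid3 {S : Finset V} (hS : 4 ≤ S.card) (a b d : V) :
    ∃ z ∈ S, z ≠ a ∧ z ≠ b ∧ z ≠ d := by
  classical
  have h : ({a, b, d} : Finset V).card < S.card :=
    lt_of_le_of_lt Finset.card_le_three (by omega)
  obtain ⟨z, hz, hz'⟩ := Finset.exists_mem_notMem_of_card_lt_card h
  simp only [Finset.mem_insert, Finset.mem_singleton, not_or] at hz'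
  exact ⟨z, hz, hz'⟩

theorem fact4 (hM : RbM G c U M) (hno : ∀ N, RbM G c U N → N.card ≤ M.card) {e : Sym2 V}
    (he : e ∈ M) (hA : rbA G c U M e) {p q : V}
    (hp : p ∈ rbW U M) (hq : q ∈ rbW U M) (hpq : G.Adj p q) (hc : c s(p, q) = c e) : False := by
  obtain ⟨x, hx, h4⟩ := hA
  obtain ⟨z, hz, h1, h2, _⟩ := avoid3 h4 p q q
  exact swap1 hM hno he hx hz hp hq hpq hc h1.symm h2.symm

theorem fact5 (hM : RbM G c U M) (hno : ∀ N, RbM G c U N → N.card ≤ M.card) {e f : Sym2 V}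
    (he : e ∈ M) (hf : f ∈ M) (hef : e ≠ f) (hA : rbA G c U M e) (hB : rbB G c U M f) {v w : V}
    (hv : v ∈ f) (hw : w ∈ rbW U M) (hvw : G.Adj v w) (hc : c s(v, w) = c e) : False := by
  classical
  obtain ⟨x, hx, h4⟩ := hA
  obtain ⟨p, q, hp, hq, hpq, hcf, hpw, hqw⟩ := hB w
  obtain ⟨z, hz, hz1, hz2, hz3⟩ := avoid3 h4 w p q
  rw [mem_rbNew] at hz
  have hM' : RbM G c U ((M.erase e).erase f) :=
    hM.subset ((Finset.erase_subset _ _).trans (Finset.erase_subset _ _))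
  have hWp := mem_rbW.1 hp
  have hWq := mem_rbW.1 hq
  have hWw := mem_rbW.1 hw
  have hWz := mem_rbW.1 hz.1
  have hmem : ∀ g ∈ (M.erase e).erase f, g ∈ M ∧ g ≠ e ∧ g ≠ f := by
    intro g hg
    simp only [Finset.mem_erase] at hg
    exact ⟨hg.2.2, hg.2.1, hg.1⟩
  have hvx : v ≠ x := by
    rintro rfl
    exact hef (hM.disj e he f hf v hx hv)
  obtain ⟨N, hN, hNc⟩ := hM'.add3 (hM.inU f hf v hv) hWw.1 hWp.1 hWq.1 (hM.inU e he x hx) hWz.1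
    hvw hpq hz.2.1
    (fun g hg hvg => (hmem g hg).2.2 (hM.disj g (hmem g hg).1 f hf v hvg hv))
    (fun g hg => hWw.2 g (hmem g hg).1)
    (fun g hg => hWp.2 g (hmem g hg).1)
    (fun g hg => hWq.2 g (hmem g hg).1)
    (fun g hg hvg => (hmem g hg).2.1 (hM.disj g (hmem g hg).1 e he x hvg hx))
    (fun g hg => hWz.2 g (hmem g hg).1)
    (ne_of_W hf hv hp) (ne_of_W hf hv hq) hvx (ne_of_W hf hv hz.1)
    hpw.symm hqw.symm (ne_of_W he hx hw).symm hz1.symm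
    (ne_of_W he hx hp).symm hz2.symm (ne_of_W he hx hq).symm hz3.symm
    (fun g hg h => (hmem g hg).2.1 (hM.inj g (hmem g hg).1 e he (h.trans hc)))
    (fun g hg h => (hmem g hg).2.2 (hM.inj g (hmem g hg).1 f hf (h.trans hcf)))
    (fun g hg => hz.2.2 g (hmem g hg).1)
    (by rw [hc, hcf]; exact fun h => hef (hM.inj e he f hf h))
    (by rw [hc]; exact hz.2.2 e he)
    (by rw [hcf]; exact hz.2.2 f hf)
  have h1 := hno N hN
  have h2 := Finset.card_erase_add_one he
  have h3 := Finset.card_erase_add_one (Finset.mem_erase.2 ⟨hef.symm, hf⟩)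
  omega

open Classical in
theorem pair_count (S : Finset (V × V)) (T : V → Finset V) (x y : V)
    (h1 : ∀ p ∈ S, p.1 = x ∨ p.1 = y) (h2 : ∀ p ∈ S, p.2 ∈ T p.1) :
    S.card ≤ (T x).card + (T y).card := by
  have hs : S ⊆ (T x).image (fun w => (x, w)) ∪ (T y).image (fun w => (y, w)) := by
    rintro ⟨v, w⟩ hp
    have h4 := h2 _ hp
    rcases h1 _ hp with h | h <;> simp only at h h4 <;> subst h <;> simp [h4]
  refine (Finset.card_le_card hs).trans ((Finset.card_union_le _ _).trans ?_)
  exact add_le_add Finset.card_image_le Finset.card_image_le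

end facts

open Classical in
/-- Ordered pairs (vertex, uncovered vertex) that are adjacent. -/
noncomputable def rbPr {V : Type*} (G : SimpleGraph V) (U : Finset V)
    (M : Finset (Sym2 V)) : Finset (V × V) :=
  (U ×ˢ rbW U M).filter (fun p => G.Adj p.1 p.2)

theorem mem_rbPr {V : Type*} {G : SimpleGraph V} {U : Finset V} {M : Finset (Sym2 V)} {p : V × V} :
    p ∈ rbPr G U M ↔ p.1 ∈ U ∧ p.2 ∈ rbW U M ∧ G.Adj p.1 p.2 := by
  simp [rbPr, and_assoc]

open Classical in
/-- Charge set of `e`. -/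
noncomputable def rbD {V : Type*} (G : SimpleGraph V) (c : Sym2 V → ℕ) (U : Finset V)
    (M : Finset (Sym2 V)) (e : Sym2 V) : Finset (V × V) :=
  if rbB G c U M e then (rbPr G U M).filter (fun p => c s(p.1, p.2) = c e)
  else if rbA G c U M e then (rbPr G U M).filter (fun p => p.1 ∈ e)
  else ((rbPr G U M).filter (fun p => p.1 ∈ rbW U M ∧ c s(p.1, p.2) = c e) ∪
    (rbPr G U M).filter (fun p => p.1 ∈ e ∧ ∀ f ∈ M, rbB G c U M f → c f ≠ c s(p.1, p.2))) ∪
    (rbPr G U M).filter (fun p => c s(p.1, p.2) = c e ∧ ∃ f ∈ M, rbB G c U M f ∧ p.1 ∈ f)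

section facts2
variable {V : Type*} {G : SimpleGraph V} {c : Sym2 V → ℕ} {U : Finset V}
    {M : Finset (Sym2 V)}

theorem cover (hM : RbM G c U M) (hno : ∀ N, RbM G c U N → N.card ≤ M.card) {p : V × V}
    (hp : p ∈ rbPr G U M) : ∃ e ∈ M, p ∈ rbD G c U M e := by
  classical
  have hp' := mem_rbPr.1 hp
  by_cases h1 : ∃ e ∈ M, rbB G c U M e ∧ c e = c s(p.1, p.2)
  · obtain ⟨e, he, hB, hc⟩ := h1
    refine ⟨e, he, ?_⟩
    rw [rbD, if_pos hB]
    exact Finset.mem_filter.2 ⟨hp, hc.symm⟩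
  push Not at h1
  by_cases h2 : p.1 ∈ rbW U M
  · obtain ⟨e, he, hc⟩ := fact1 hM hno h2 hp'.2.1 hp'.2.2
    refine ⟨e, he, ?_⟩
    have hB : ¬ rbB G c U M e := fun h => h1 e he h hc
    have hA : ¬ rbA G c U M e := fun h => fact4 hM hno he h h2 hp'.2.1 hp'.2.2 hc.symm
    rw [rbD, if_neg hB, if_neg hA]
    simp [hp, h2, hc]
  · obtain ⟨e, he, hpe⟩ : ∃ e ∈ M, p.1 ∈ e := by
      by_contra hcon
      push Not at hcon
      exact h2 (mem_rbW.2 ⟨hp'.1, hcon⟩)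
    by_cases hB : rbB G c U M e
    · obtain ⟨f, hf, hc⟩ : ∃ f ∈ M, c f = c s(p.1, p.2) := by
        by_contra hcon
        push Not at hcon
        exact fact2 hM hno he hB hpe (mem_rbNew.2 ⟨hp'.2.1, hp'.2.2, hcon⟩)
      refine ⟨f, hf, ?_⟩
      have hBf : ¬ rbB G c U M f := fun h => h1 f hf h hc
      have hA : ¬ rbA G c U M f := fun h =>
        fact5 hM hno hf he (fun h' => hBf (h' ▸ hB)) h hB hpe hp'.2.1 hp'.2.2 hc.symm
      rw [rbD, if_neg hBf, if_neg hA]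
      refine Finset.mem_union_right _ (Finset.mem_filter.2 ⟨hp, hc.symm, e, he, hB, hpe⟩)
    · refine ⟨e, he, ?_⟩
      rw [rbD, if_neg hB]
      split_ifs with hA
      · exact Finset.mem_filter.2 ⟨hp, hpe⟩
      · refine Finset.mem_union_left _ (Finset.mem_union_right _
          (Finset.mem_filter.2 ⟨hp, hpe, fun f hf hBf => h1 f hf hBf⟩))

open Classical in
theorem charge_le {m : ℕ} (hm : 2 ≤ m) (hpr : PropC G c) (hM : RbM G c U M) (hMc : M.card = m)
    (hno : ∀ N, RbM G c U N → N.card ≤ M.card)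
    (hdeg : ∀ x ∈ U, (U.filter (fun w => G.Adj x w)).card ≤ 3 * m)
    (hcol : ∀ q, ((U ×ˢ U).filter (fun p => G.Adj p.1 p.2 ∧ c s(p.1, p.2) = q)).card ≤ 4 * m)
    {e : Sym2 V} (he : e ∈ M) : (rbD G c U M e).card ≤ 4 * m := by
  rw [rbD]
  split_ifs with hB hA
  · refine (Finset.card_le_card ?_).trans (hcol (c e))
    intro p hp
    rw [Finset.mem_filter, mem_rbPr] at hp
    rw [Finset.mem_filter, Finset.mem_product]
    exact ⟨⟨hp.1.1, (mem_rbW.1 hp.1.2.1).1⟩, hp.1.2.2, hp.2⟩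
  · obtain ⟨x, hx, h4⟩ := hA
    obtain ⟨y, rfl⟩ := Sym2.mem_iff_exists.1 hx
    have hy0 := fact3 hpr hM hno he (by omega)
    have hxy : x ≠ y := (hM.adj _ he : G.Adj x y).ne
    have h := pair_count ((rbPr G U M).filter (fun p => p.1 ∈ s(x, y)))
      (fun v => if v = x then U.filter (fun w => G.Adj x w) else
        U.filter (fun w => G.Adj y w ∧ ∃ e ∈ M, c e = c s(y, w))) x y
      (by
        intro p hp
        exact Sym2.mem_iff.1 (Finset.mem_filter.1 hp).2)
      (by
        rintro ⟨v, w⟩ hp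
        rw [Finset.mem_filter, mem_rbPr] at hp
        obtain ⟨⟨h1, h2, h3⟩, h5⟩ := hp
        simp only at h1 h2 h3 h5 ⊢
        have hwU := (mem_rbW.1 h2).1
        split_ifs with hvx
        · subst hvx
          exact Finset.mem_filter.2 ⟨hwU, h3⟩
        · have hvy : v = y := (Sym2.mem_iff.1 h5).resolve_left hvx
          subst hvy
          refine Finset.mem_filter.2 ⟨hwU, h3, ?_⟩
          by_contra hcon
          push Not at hcon
          have : w ∈ rbNew G c U M v := mem_rbNew.2 ⟨h2, h3, hcon⟩
          rw [hy0] at this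
          simp at this)
    simp only [if_true, if_neg hxy.symm] at h
    have h1 := hdeg x (hM.inU _ he x hx)
    have h2 := card_col_le hpr U M y
    omega
  · have hp1 : ((rbPr G U M).filter (fun p => p.1 ∈ rbW U M ∧ c s(p.1, p.2) = c e)).card ≤ 2 := by
      rw [rbB] at hB
      push Not at hB
      obtain ⟨w, hw⟩ := hB
      set S := (rbPr G U M).filter (fun p => p.1 ∈ rbW U M ∧ c s(p.1, p.2) = c e) with hS
      have hmem : ∀ p ∈ S, p.1 ∈ rbW U M ∧ p.2 ∈ rbW U M ∧ G.Adj p.1 p.2 ∧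
          c s(p.1, p.2) = c e := by
        intro p hp
        rw [hS, Finset.mem_filter, mem_rbPr] at hp
        exact ⟨hp.2.1, hp.1.2.1, hp.1.2.2, hp.2.2⟩
      have hsub : S ⊆ S.filter (fun p => p.1 = w) ∪ S.filter (fun p => p.2 = w) := by
        intro p hp
        obtain ⟨h1, h2, h3, h4⟩ := hmem p hp
        have := hw p.1 p.2 h1 h2 h3 h4
        simp only [Finset.mem_union, Finset.mem_filter, hp, true_and]
        tauto
      have ha : (S.filter (fun p => p.1 = w)).card ≤ 1 := by
        rw [Finset.card_le_one]
        rintro ⟨a1, a2⟩ ha ⟨b1, b2⟩ hb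
        rw [Finset.mem_filter] at ha hb
        obtain ⟨ha, rfl⟩ := ha
        obtain ⟨hb, hb'⟩ := hb
        simp only at hb'
        subst hb'
        obtain ⟨-, -, h3, h4⟩ := hmem _ ha
        obtain ⟨-, -, h5, h6⟩ := hmem _ hb
        have := hpr _ _ _ h3 h5 (h4.trans h6.symm)
        simp only at this
        rw [this]
      have hb0 : (S.filter (fun p => p.2 = w)).card ≤ 1 := by
        rw [Finset.card_le_one]
        rintro ⟨a1, a2⟩ ha1 ⟨b1, b2⟩ hb
        rw [Finset.mem_filter] at ha1 hb
        obtain ⟨ha1, rfl⟩ := ha1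
        obtain ⟨hb, hb'⟩ := hb
        simp only at hb'
        subst hb'
        obtain ⟨-, -, h3, h4⟩ := hmem _ ha1
        obtain ⟨-, -, h5, h6⟩ := hmem _ hb
        have := hpr _ _ _ h3.symm h5.symm (by
          rw [Sym2.eq_swap, h4, Sym2.eq_swap, h6])
        simp only at this
        rw [this]
      have := (Finset.card_le_card hsub).trans (Finset.card_union_le _ _)
      omega
    have hp3 : ((rbPr G U M).filter
        (fun p => c s(p.1, p.2) = c e ∧ ∃ f ∈ M, rbB G c U M f ∧ p.1 ∈ f)).card ≤
        2 * (M.filter (fun f => rbB G c U M f)).card := by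
      refine le_trans ?_ (card_cover_le U (M.filter (fun f => rbB G c U M f)))
      refine Finset.card_le_card_of_injOn Prod.fst ?_ ?_
      · intro p hp
        rw [Finset.mem_coe, Finset.mem_filter, mem_rbPr] at hp
        obtain ⟨⟨h1, -, -⟩, -, f, hf, hBf, hpf⟩ := hp
        rw [Finset.mem_coe, Finset.mem_filter]
        exact ⟨h1, f, Finset.mem_filter.2 ⟨hf, hBf⟩, hpf⟩
      · rintro ⟨a1, a2⟩ ha ⟨b1, b2⟩ hb hab
        rw [Finset.mem_coe, Finset.mem_filter, mem_rbPr] at ha hb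
        simp only at ha hb hab
        subst hab
        rw [hpr _ _ _ ha.1.2.2 hb.1.2.2 (ha.2.1.trans hb.2.1.symm)]
    have hp2 : ((rbPr G U M).filter
        (fun p => p.1 ∈ e ∧ ∀ f ∈ M, rbB G c U M f → c f ≠ c s(p.1, p.2))).card ≤
        4 + 2 * ((M.filter (fun f => ¬ rbB G c U M f)).erase e).card := by
      set K := (M.filter (fun f => ¬ rbB G c U M f)).erase e with hK
      induction e with
      | h x y =>
      have hxy : G.Adj x y := hM.adj _ he
      have hnx : (rbNew G c U M x).card ≤ 3 := by
        by_contra h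
        exact hA ⟨x, by simp, by omega⟩
      have hny : (rbNew G c U M y).card ≤ 3 := by
        by_contra h
        exact hA ⟨y, by simp, by omega⟩
      have hn : (rbNew G c U M x).card + (rbNew G c U M y).card ≤ 4 := by
        have h1 : 3 ≤ (rbNew G c U M x).card → (rbNew G c U M y).card = 0 := fun h => by
          rw [fact3 hpr hM hno he h, Finset.card_empty]
        have h2 : 3 ≤ (rbNew G c U M y).card → (rbNew G c U M x).card = 0 := fun h => by
          rw [fact3 hpr hM hno (x := y) (y := x) (by rwa [Sym2.eq_swap]) h, Finset.card_empty]
        omega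
      have h := pair_count ((rbPr G U M).filter
        (fun p => p.1 ∈ s(x, y) ∧ ∀ f ∈ M, rbB G c U M f → c f ≠ c s(p.1, p.2)))
        (fun v => rbNew G c U M v ∪ U.filter (fun w => G.Adj v w ∧ ∃ f ∈ K, c f = c s(v, w))) x y
        (by
          intro p hp
          exact Sym2.mem_iff.1 (Finset.mem_filter.1 hp).2.1)
        (by
          rintro ⟨v, w⟩ hp
          rw [Finset.mem_filter, mem_rbPr] at hp
          obtain ⟨⟨h1, h2, h3⟩, h5, h6⟩ := hp
          simp only at h1 h2 h3 h5 h6 ⊢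
          rw [Finset.mem_union, mem_rbNew, Finset.mem_filter]
          by_cases hold : ∃ f ∈ M, c f = c s(v, w)
          · right
            obtain ⟨f, hf, hcf⟩ := hold
            refine ⟨(mem_rbW.1 h2).1, h3, f, ?_, hcf⟩
            rw [hK, Finset.mem_erase, Finset.mem_filter]
            refine ⟨?_, hf, fun h => h6 f hf h hcf⟩
            rintro rfl
            rcases Sym2.mem_iff.1 h5 with rfl | rfl
            · have := hpr _ _ _ hxy h3 hcf
              exact ne_of_W (v := y) he (by simp) h2 this
            · have := hpr _ _ _ hxy.symm h3 (by rw [Sym2.eq_swap]; exact hcf)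
              exact ne_of_W (v := x) he (by simp) h2 this
          · push Not at hold
            exact Or.inl ⟨h2, h3, hold⟩)
      have hx1 := Finset.card_union_le (rbNew G c U M x)
        (U.filter (fun w => G.Adj x w ∧ ∃ f ∈ K, c f = c s(x, w)))
      have hy1 := Finset.card_union_le (rbNew G c U M y)
        (U.filter (fun w => G.Adj y w ∧ ∃ f ∈ K, c f = c s(y, w)))
      have hx2 := card_col_le hpr U K x
      have hy2 := card_col_le hpr U K y
      omega
    have hce := Finset.card_erase_add_one (s := M.filter (fun f => ¬ rbB G c U M f)) (a := e)
      (Finset.mem_filter.2 ⟨he, hB⟩)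
    have hsum := Finset.card_filter_add_card_filter_not (s := M) (fun f => rbB G c U M f)
    refine (Finset.card_union_le _ _).trans ?_
    have hu := Finset.card_union_le
      ((rbPr G U M).filter (fun p => p.1 ∈ rbW U M ∧ c s(p.1, p.2) = c e))
      ((rbPr G U M).filter (fun p => p.1 ∈ e ∧ ∀ f ∈ M, rbB G c U M f → c f ≠ c s(p.1, p.2)))
    omega

end facts2

open Classical in
theorem step_big {V : Type*} {c : Sym2 V → ℕ} {m : ℕ} (hm : 2 ≤ m) (ih : RbP V c m)
    {G : SimpleGraph V} {U : Finset V} (hp : PropC G c)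
    (ht : ∀ x y z, G.Adj x y → G.Adj y z → G.Adj x z → False)
    (hd : ∀ v ∈ U, m + 1 ≤ (U.filter (fun w => G.Adj v w)).card) (hU : rbOrd (m + 1) ≤ U.card)
    (hno : ∀ M, RbM G c U M → M.card ≤ m) : False := by
  obtain ⟨M, hM, hMc⟩ := ih G U hp ht (fun v hv => (Nat.le_succ m).trans (hd v hv))
    (by have := rbOrd_succ m; omega)
  have hno' : ∀ N, RbM G c U N → N.card ≤ M.card := by rw [hMc]; exact hno
  have hUc : 6 * m ≤ U.card + 2 := by
    obtain ⟨n, rfl⟩ : ∃ n, m = n + 2 := ⟨m - 2, by omega⟩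
    have : rbOrd (n + 2 + 1) = 6 * n + 10 := rfl
    omega
  have hW : 4 * m ≤ (rbW U M).card + 2 := by
    have h1 := card_cover_le U M
    have h2 := Finset.card_filter_add_card_filter_not (s := U) (fun v => ∃ e ∈ M, v ∈ e)
    have h3 : U.filter (fun v => ¬ ∃ e ∈ M, v ∈ e) = rbW U M := by
      ext v; simp [mem_rbW]
    rw [h3] at h2
    omega
  have hlow : (m + 1) * (rbW U M).card ≤ (rbPr G U M).card := by
    rw [mul_comm]
    have hfib := Finset.card_eq_sum_card_fiberwise (s := rbPr G U M) (t := rbW U M)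
      (f := Prod.snd) (fun p hpp => (mem_rbPr.1 hpp).2.1)
    rw [hfib, ← smul_eq_mul]
    refine Finset.card_nsmul_le_sum _ _ _ ?_
    intro w hw
    refine (hd w (mem_rbW.1 hw).1).trans ?_
    refine Finset.card_le_card_of_injOn (fun v => (v, w)) ?_ ?_
    · intro v hv
      rw [Finset.mem_coe, Finset.mem_filter] at hv
      rw [Finset.mem_coe, Finset.mem_filter, mem_rbPr]
      exact ⟨⟨hv.1, hw, hv.2.symm⟩, rfl⟩
    · intro a _ b _ hab
      exact congrArg Prod.fst hab
  have hup : (rbPr G U M).card ≤ M.card * (4 * m) := by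
    refine le_trans (Finset.card_le_card (t := M.biUnion (rbD G c U M)) ?_)
      (Finset.card_biUnion_le_card_mul _ _ _ ?_)
    · intro p hpp
      obtain ⟨e, he, h⟩ := cover hM hno' hpp
      exact Finset.mem_biUnion.2 ⟨e, he, h⟩
    · intro e he
      exact charge_le hm hp hM hMc hno' (deg_bound ih hp ht hd hU hno)
        (col_bound ih hp ht hd hU hno) he
  rw [hMc] at hup
  nlinarith

theorem rbMain (V : Type*) (c : Sym2 V → ℕ) (k : ℕ) : RbP V c k := by
  classical
  induction k with
  | zero =>
    intro G U _ _ _ _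
    exact ⟨∅, ⟨by simp, by simp, by simp, by simp⟩, rfl⟩
  | succ m ih =>
    intro G U hp ht hd hU
    by_contra hcon
    have hno : ∀ M, RbM G c U M → M.card ≤ m := by
      intro M hM
      by_contra h
      obtain ⟨N, hN, hNc⟩ := Finset.exists_subset_card_eq (s := M) (n := m + 1) (by omega)
      exact hcon ⟨N, hM.subset hN, hNc⟩
    have hd' : ∀ v ∈ U, m + 1 ≤ (U.filter (fun w => G.Adj v w)).card := by
      intro v hv
      convert hd v hv
    rcases Nat.lt_or_ge m 2 with h | h
    · interval_cases m
      · have hU1 : 1 ≤ U.card := hU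
        obtain ⟨x, hx⟩ : U.Nonempty := by rw [← Finset.card_pos]; omega
        have h1 := hd' x hx
        obtain ⟨y, hy⟩ : (U.filter (fun w => G.Adj x w)).Nonempty := by
          rw [← Finset.card_pos]; omega
        rw [Finset.mem_filter] at hy
        have hM0 : RbM G c U ∅ := ⟨by simp, by simp, by simp, by simp⟩
        obtain ⟨h2, h3⟩ := hM0.ins hx hy.1 hy.2 (by simp) (by simp) (by simp)
        have := hno _ h2
        omega
      · exact step_small ih hp ht (fun v hv => by convert hd' v hv) hU hno
    · exact step_big h ih hp ht (fun v hv => by convert hd' v hv) hU hno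

theorem rbOrd_le_of_real (d n : ℕ) (hd : 1 ≤ d)
    (h : (49 : ℝ) / 8 * d - 21 / 2 + 9 / (2 * d) < (n : ℝ)) : rbOrd d ≤ n := by
  match d, hd with
  | 1, _ =>
    have : (0 : ℝ) < n := by norm_num at h; linarith
    have : 0 < n := by exact_mod_cast this
    exact this
  | 2, _ =>
    have : 4 < n := by norm_num at h; exact h
    exact this
  | (k + 3), _ =>
    have hpos : (0 : ℝ) < ((k + 3 : ℕ) : ℝ) := by positivity
    have hk : ((k + 3 : ℕ) : ℝ) = k + 3 := by push_cast; ring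
    have h1 : 6 * ((k + 3 : ℕ) : ℝ) - 9 ≤
        (49 : ℝ) / 8 * ((k + 3 : ℕ) : ℝ) - 21 / 2 + 9 / (2 * ((k + 3 : ℕ) : ℝ)) := by
      generalize ((k + 3 : ℕ) : ℝ) = d at hpos
      have : (49 : ℝ) / 8 * d - 21 / 2 + 9 / (2 * d) - (6 * d - 9) = (d - 6) ^ 2 / (8 * d) := by
        field_simp
        ring
      have h2 : 0 ≤ (d - 6) ^ 2 / (8 * d) := by positivity
      linarith
    have h2 : (6 * (k : ℝ) + 9) < n := by rw [hk] at h1 h; linarith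
    have h3 : 6 * k + 9 < n := by exact_mod_cast h2
    exact h3

theorem rainbow_matching_of_large_order_triangle_free {V : Type*} [Fintype V] [DecidableEq V]
    (G : SimpleGraph V) [DecidableRel G.Adj] (c : Sym2 V → ℕ)
    (hc : IsProperEdgeColoring G c) (htf : G.CliqueFree 3)
    (hn : (49 : ℝ) / 8 * G.minDegree - 21 / 2 + 9 / (2 * G.minDegree)
        < (Fintype.card V : ℝ)) :
    ∃ M : Finset (Sym2 V), IsRainbowMatching G c M ∧ M.card = G.minDegree := by
  have hord : rbOrd G.minDegree ≤ (Finset.univ : Finset V).card := by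
    rcases Nat.eq_zero_or_pos G.minDegree with h | h
    · rw [h]; exact Nat.zero_le _
    · exact rbOrd_le_of_real _ _ h hn
  have hp : PropC G c := by
    intro u v w huv huw h
    by_contra hne
    refine hc s(u, v) huv s(u, w) huw ?_ ⟨u, by simp, by simp⟩ h
    intro heq
    rw [Sym2.eq_iff] at heq
    rcases heq with h | h
    · exact hne h.2
    · exact hne (h.2.trans h.1)
  have ht : ∀ x y z, G.Adj x y → G.Adj y z → G.Adj x z → False := by
    intro x y z h1 h2 h3
    exact htf {x, y, z} (SimpleGraph.is3Clique_triple_iff.2 ⟨h1, h3, h2⟩)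
  obtain ⟨M, hM, hMc⟩ := rbMain V c G.minDegree G Finset.univ hp ht (by
    intro v _
    have h := G.minDegree_le_degree v
    rw [← SimpleGraph.card_neighborFinset_eq_degree] at h
    refine h.trans (Finset.card_le_card ?_)
    intro w hw
    simpa using hw) hord
  refine ⟨M, ⟨fun e he => hM.adj e he, ?_, fun e he f hf h => hM.inj e he f hf h⟩, hMc⟩
  intro e he f hf hef v hve hvf
  exact hef (hM.disj e he f hf v hve hvf)
end

section
/- Let G be a properly edge-colored graph with minimum degree δ ≥ 2 containing a vertex v of degree greater than 3δ − 3. If G − v contains a rainbow matching of size δ − 1, then G contains a rainbow matching of size δ. -/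
open SimpleGraph

/-- Lemma 1 (max degree): if some vertex has degree `> 3δ - 3` and `G - v` has a rainbow
matching of size `δ - 1` (i.e. a rainbow matching of `G` avoiding `v`), then `G` has a
rainbow matching of size `δ`. -/
theorem rainbow_matching_of_max_degree {V : Type*} [Fintype V] [DecidableEq V]
    (G : SimpleGraph V) [DecidableRel G.Adj] (c : Sym2 V → ℕ)
    (hc : IsProperEdgeColoring G c) (hδ : 2 ≤ G.minDegree) (v : V)
    (hv : 3 * G.minDegree - 3 < G.degree v)
    (hM : ∃ M : Finset (Sym2 V), IsRainbowMatching G c M ∧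
      M.card = G.minDegree - 1 ∧ ∀ e ∈ M, v ∉ e) :
    ∃ M : Finset (Sym2 V), IsRainbowMatching G c M ∧ M.card = G.minDegree := by
  classical
  obtain ⟨M, ⟨hMG, hMd, hMc⟩, hcard, hMv⟩ := hM
  have key : ∃ w, G.Adj v w ∧ (∀ e ∈ M, w ∉ e) ∧ c s(v, w) ∉ M.image c := by
    by_contra hcon
    push Not at hcon
    have hsub : G.neighborFinset v ⊆ (M.biUnion fun e => e.toFinset) ∪
        (G.neighborFinset v).filter (fun w => c s(v, w) ∈ M.image c) := by
      intro w hw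
      rw [mem_neighborFinset] at hw
      by_cases h : ∀ e ∈ M, w ∉ e
      · exact Finset.mem_union_right _
          (Finset.mem_filter.2 ⟨(mem_neighborFinset _ _ _).2 hw, hcon w hw h⟩)
      · push Not at h
        obtain ⟨e, he, hwe⟩ := h
        exact Finset.mem_union_left _
          (Finset.mem_biUnion.2 ⟨e, he, Sym2.mem_toFinset.2 hwe⟩)
    have h1 : (M.biUnion fun e => e.toFinset).card ≤ M.card * 2 := by
      apply Finset.card_biUnion_le_card_mul
      intro e _
      rw [Sym2.card_toFinset]
      split_ifs <;> omega
    have h2 : ((G.neighborFinset v).filter (fun w => c s(v, w) ∈ M.image c)).card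
        ≤ M.card := by
      refine le_trans ?_ (Finset.card_image_le (s := M) (f := c))
      apply Finset.card_le_card_of_injOn (fun w => c s(v, w))
      · intro w hw
        exact (Finset.mem_filter.1 hw).2
      · intro a ha b hb hab
        have ha' := (mem_neighborFinset _ _ _).1 (Finset.mem_filter.1 ha).1
        have hb' := (mem_neighborFinset _ _ _).1 (Finset.mem_filter.1 hb).1
        by_contra hne
        refine hc s(v, a) ha' s(v, b) hb' ?_ ⟨v, by simp, by simp⟩ hab
        intro h
        exact hne (Sym2.congr_right.1 h)
    have h3 := (Finset.card_le_card hsub).trans (Finset.card_union_le _ _)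
    rw [card_neighborFinset_eq_degree] at h3
    omega
  obtain ⟨w, hw, hwM, hwc⟩ := key
  have hnot : s(v, w) ∉ M := fun h => hMv _ h (by simp)
  have hdis : ∀ e ∈ M, ∀ x, x ∈ s(v, w) → x ∉ e := by
    intro e he x hx
    rcases Sym2.mem_iff.1 hx with rfl | rfl
    · exact hMv e he
    · exact hwM e he
  refine ⟨insert s(v, w) M, ⟨?_, ?_, ?_⟩, ?_⟩
  · intro e he
    rcases Finset.mem_insert.1 (Finset.mem_coe.1 he) with rfl | he
    · exact hw
    · exact hMG he
  · intro e he f hf hne x hxe hxf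
    rcases Finset.mem_insert.1 (Finset.mem_coe.1 he) with rfl | he <;>
    rcases Finset.mem_insert.1 (Finset.mem_coe.1 hf) with rfl | hf
    · exact hne rfl
    · exact hdis f hf x hxe hxf
    · exact hdis e he x hxf hxe
    · exact hMd he hf hne x hxe hxf
  · intro e he f hf hef
    rcases Finset.mem_insert.1 (Finset.mem_coe.1 he) with rfl | he <;>
    rcases Finset.mem_insert.1 (Finset.mem_coe.1 hf) with rfl | hf
    · rfl
    · exact absurd (Finset.mem_image.2 ⟨f, hf, hef.symm⟩) hwc
    · exact absurd (Finset.mem_image.2 ⟨e, he, hef⟩) hwc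
    · exact hMc he hf hef
  · rw [Finset.card_insert_of_notMem hnot, hcard]
    omega
end
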